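/- Let F : ℝ³ → ℝ, written F(x,y,t), be three times continuously differentiable and satisfy the two linear partial differential equations (a) ∂²F/∂x² = ∂²F/∂y² and (b) ∂F/∂t + (∂/∂x + ∂/∂y)³F = 0. Let K : ℝ³ → ℝ be three times continuously differentiable and solve, for every t, the integral equation K(x,y,t) = F(x,y,t) + ∫ₓ^∞ F(z,y,t) K(x,z,t) dz. Assume: (i) for all non-negative integers k, s, n with k + s + n ≤ 3, (∂^k F/∂z^k)(z,y,t)·(∂^{s+n}K/∂x^s∂z^n)(x,z,t) → 0 as z → ∞; (ii) the improper integrals ∫ₓ^∞ of all partial derivatives of total order ≤ 3 of F(z,y,t)K(x,z,t) converge uniformly on compact sets; (iii) for every x and t, the only continuous function φ with ∫ₓ^∞|F(z,y,t)φ(z)|dz < ∞ satisfying φ(y) = ∫ₓ^∞ F(z,y,t)φ(z)dz for all y is φ = 0. Then K satisfies the non-linear third-order equation ∂K/∂t + (∂/∂x + ∂/∂y)³K + 6·((∂/∂x + ∂/∂y)K)(x,y,t)·(∂/∂x)[x ↦ K(x,x,t)] = 0 for all x, y, t, where (∂/∂x)[x ↦ K(x,x,t)] is the derivative of the diagonal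 function x ↦ K(x,x,t). -/

import Mathlib

open MeasureTheory Filter

/-- Partial derivative in the first argument of a function of three real variables. -/
noncomputable def d1₁₄ (G : ℝ → ℝ → ℝ → ℝ) : ℝ → ℝ → ℝ → ℝ :=
  fun x y t => deriv (fun s => G s y t) x

/-- Partial derivative in the second argument of a function of three real variables. -/
noncomputable def d2₁₄ (G : ℝ → ℝ → ℝ → ℝ) : ℝ → ℝ → ℝ → ℝ :=
  fun x y t => deriv (fun s => G x s t) y

/-- Partial derivative in the third argument of a function of three real variables. -/
noncomputable def d3₁₄ (G : ℝ → ℝ → ℝ → ℝ) : ℝ → ℝ → ℝ → ℝ :=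
  fun x y t => deriv (fun s => G x y s) t

/-- The operator `∂/∂x + ∂/∂y` on functions of `(x, y, t)`. -/
noncomputable def DXY₁₄ (G : ℝ → ℝ → ℝ → ℝ) : ℝ → ℝ → ℝ → ℝ :=
  fun x y t => d1₁₄ G x y t + d2₁₄ G x y t

/-- Partial derivative in the first argument of a function of four real variables. -/
noncomputable def e1₁₄ (H : ℝ → ℝ → ℝ → ℝ → ℝ) : ℝ → ℝ → ℝ → ℝ → ℝ :=
  fun a b c d => deriv (fun s => H s b c d) a

/-- Partial derivative in the second argument of a function of four real variables. -/
noncomputable def e2₁₄ (H : ℝ → ℝ → ℝ → ℝ → ℝ) : ℝ → ℝ → ℝ → ℝ → ℝ :=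
  fun a b c d => deriv (fun s => H a s c d) b

/-- Partial derivative in the third argument of a function of four real variables. -/
noncomputable def e3₁₄ (H : ℝ → ℝ → ℝ → ℝ → ℝ) : ℝ → ℝ → ℝ → ℝ → ℝ :=
  fun a b c d => deriv (fun s => H a b s d) c

/-- Partial derivative in the fourth argument of a function of four real variables. -/
noncomputable def e4₁₄ (H : ℝ → ℝ → ℝ → ℝ → ℝ) : ℝ → ℝ → ℝ → ℝ → ℝ :=
  fun a b c d => deriv (fun s => H a b c s) d


theorem div_sqrt_facts (w η : ℝ) (hη : 0 < η) (hw : 0 ≤ w) :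
    0 ≤ w / √(w^2+η^2) ∧ w / √(w^2+η^2) ≤ 1 ∧ w - η ≤ w * (w / √(w^2+η^2)) := by
  have hr : 0 < √(w^2+η^2) := by positivity
  have hsq : √(w^2+η^2)^2 = w^2+η^2 := Real.sq_sqrt (by positivity)
  have h1 : w ≤ √(w^2+η^2) := Real.le_sqrt_of_sq_le (by nlinarith)
  refine ⟨by positivity, (div_le_one hr).2 h1, ?_⟩
  rw [← mul_div_assoc, le_div_iff₀ hr]
  nlinarith

theorem sign_aux_pos (p s η : ℝ) (hη : 0 < η) (hp : 0 ≤ p) (hs : 0 ≤ s) :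
    p * s - η * (p + s) * 3 ≤ p * s * ((p+s) / √((p+s)^2+η^2) * (p / √(p^2+η^2) + s / √(s^2+η^2)) - 1) := by
  obtain ⟨a1, a2, a3⟩ := div_sqrt_facts p η hη hp
  obtain ⟨b1, b2, b3⟩ := div_sqrt_facts s η hη hs
  obtain ⟨c1, c2, c3⟩ := div_sqrt_facts (p+s) η hη (add_nonneg hp hs)
  set P := p / √(p^2+η^2)
  set S := s / √(s^2+η^2)
  set T := (p+s) / √((p+s)^2+η^2)
  have h1 : p * (1 - T) ≤ η := by nlinarith
  have h2 : s * (1 - T) ≤ η := by nlinarith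
  have h3 : s * P * (p * (1 - T)) ≤ s * η := by
    have : P * (p * (1 - T)) ≤ 1 * η := by gcongr
    nlinarith
  have h4 : p * S * (s * (1 - T)) ≤ p * η := by
    have : S * (s * (1 - T)) ≤ 1 * η := by gcongr
    nlinarith
  have h5 : s * (p * (1 - P)) ≤ s * η := by gcongr; linarith
  have h6 : p * (s * (1 - S)) ≤ p * η := by gcongr; linarith
  nlinarith [mul_nonneg hη.le hp, mul_nonneg hη.le hs]

theorem sign_aux_neg (p s η : ℝ) (hη : 0 < η) (hp : 0 ≤ p) (hs : 0 ≤ s) (hps : s ≤ p) :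
    p * s - η * (p + s) * 3 ≤ p * s * (1 - (p-s) / √((p-s)^2+η^2) * (p / √(p^2+η^2) - s / √(s^2+η^2))) := by
  obtain ⟨a1, a2, a3⟩ := div_sqrt_facts p η hη hp
  obtain ⟨b1, b2, b3⟩ := div_sqrt_facts s η hη hs
  obtain ⟨c1, c2, c3⟩ := div_sqrt_facts (p-s) η hη (by linarith)
  set P := p / √(p^2+η^2)
  set S := s / √(s^2+η^2)
  set T := (p-s) / √((p-s)^2+η^2)
  have h6 : p * (s * (1 - S)) ≤ p * η := by gcongr; linarith
  have h7 : T * (P - S) ≤ 1 - S := by nlinarith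
  have h8 : p * s * (T * (P - S)) ≤ p * s * (1 - S) := by gcongr
  nlinarith [mul_nonneg hη.le hp, mul_nonneg hη.le hs]

theorem sign_aux (p s η : ℝ) (hη : 0 < η) :
    |p * s| - η * (|p| + |s|) * 3 ≤ p * s * ((p+s) / √((p+s)^2+η^2) * (p / √(p^2+η^2) + s / √(s^2+η^2)) - 1) := by
  rw [abs_mul]
  rcases le_total 0 p with hp | hp <;> rcases le_total 0 s with hs | hs
  · rw [abs_of_nonneg hp, abs_of_nonneg hs]
    exact sign_aux_pos p s η hη hp hs
  · rw [abs_of_nonneg hp, abs_of_nonpos hs]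
    rcases le_total (-s) p with h | h
    · convert sign_aux_neg p (-s) η hη hp (by linarith) h using 1
      simp only [sub_neg_eq_add, neg_sq]; ring
    · convert sign_aux_neg (-s) p η hη (by linarith) hp h using 1
      · ring
      · rw [show (-s - p)^2 = (p+s)^2 by ring, neg_sq]; ring
  · rw [abs_of_nonpos hp, abs_of_nonneg hs]
    rcases le_total (-p) s with h | h
    · convert sign_aux_neg s (-p) η hη hs (by linarith) h using 1
      · ring
      · rw [show (s - -p)^2 = (p+s)^2 by ring, neg_sq]; ring
    · convert sign_aux_neg (-p) s η hη (by linarith) hs h using 1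
      rw [show (-p - s)^2 = (p+s)^2 by ring, neg_sq]; ring
  · rw [abs_of_nonpos hp, abs_of_nonpos hs]
    convert sign_aux_pos (-p) (-s) η hη (by linarith) (by linarith) using 1
    rw [show (-p + -s)^2 = (p+s)^2 by ring, neg_sq, neg_sq]; ring

theorem hasDerivAt_sqrt_reg {f : ℝ → ℝ} {f' η z : ℝ} (hη : 0 < η) (hf : HasDerivAt f f' z) :
    HasDerivAt (fun z => √(f z ^ 2 + η^2)) (f z / √(f z ^2 + η^2) * f') z := by
  have hr : 0 < √(f z^2+η^2) := by positivity
  have h0 : HasDerivAt (fun z => f z ^ 2 + η^2) (2 * f z * f') z := by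
    simpa using (hf.fun_pow 2).add_const (η^2)
  refine (h0.sqrt (by positivity)).congr_deriv ?_
  field_simp

theorem hasDerivAt_sign_reg {f : ℝ → ℝ} {f' η z : ℝ} (hη : 0 < η) (hf : HasDerivAt f f' z) :
    HasDerivAt (fun z => f z / √(f z ^ 2 + η^2))
      (η^2 / (f z ^2 + η^2) / √(f z ^2 + η^2) * f') z := by
  have hr : 0 < √(f z^2+η^2) := by positivity
  have hsq : √(f z^2+η^2)^2 = f z^2+η^2 := Real.sq_sqrt (by positivity)
  refine (hf.fun_div (hasDerivAt_sqrt_reg hη hf) hr.ne').congr_deriv ?_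
  have hd : f z ^ 2 + η ^ 2 ≠ 0 := by positivity
  field_simp
  rw [hsq]
  ring


theorem sq_div_sqrt_bound (w η : ℝ) (hη : 0 < η) : |w| - η ≤ w * (w / √(w^2+η^2)) ∧ w * (w / √(w^2+η^2)) ≤ |w| := by
  have hr : 0 < √(w^2+η^2) := by positivity
  have hsq : √(w^2+η^2)^2 = w^2+η^2 := Real.sq_sqrt (by positivity)
  have h1 : |w| ≤ √(w^2+η^2) := Real.abs_le_sqrt (by nlinarith)
  have h2 : √(w^2+η^2) ≤ |w| + η := by
    apply Real.sqrt_le_iff.2 ⟨by positivity, ?_⟩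
    nlinarith [sq_abs w, abs_nonneg w]
  rw [← mul_div_assoc, le_div_iff₀ hr, div_le_iff₀ hr]
  constructor <;> nlinarith [sq_abs w, abs_nonneg w]

theorem weight_aux (p s η : ℝ) (hη : 0 < η) :
    -(|p * s| / 2) - η * (|p| + |s|) * 3 ≤
      (p+s) * ((p+s) / √((p+s)^2+η^2) * (√(p^2+η^2) - √(s^2+η^2)) + s) := by
  obtain ⟨h1, h2⟩ := sq_div_sqrt_bound (p+s) η hη
  set X := (p+s) * ((p+s) / √((p+s)^2+η^2)) with hX
  have e : (p+s) * ((p+s) / √((p+s)^2+η^2) * (√(p^2+η^2) - √(s^2+η^2)) + s)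
     = X * (√(p^2+η^2) - √(s^2+η^2)) + s * (p+s) := by rw [hX]; ring
  rw [e]
  have h3 : |p| ≤ √(p^2+η^2) := Real.abs_le_sqrt (by nlinarith)
  have h4 : √(s^2+η^2) ≤ |s| + η := by
    apply Real.sqrt_le_iff.2 ⟨by positivity, ?_⟩
    nlinarith [sq_abs s, abs_nonneg s]
  have hX0 : 0 ≤ X := by
    rw [hX, ← mul_div_assoc]; apply div_nonneg (mul_self_nonneg _) (Real.sqrt_nonneg _)
  have h5 : X * (|p| - |s| - η) ≤ X * (√(p^2+η^2) - √(s^2+η^2)) := by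
    apply mul_le_mul_of_nonneg_left _ hX0; linarith
  have h6 : |p+s| * (|p| - |s|) - η * (|p| + |s|) ≤ X * (|p| - |s|) := by
    have : (|p+s| - X) * (|p| - |s|) ≤ η * (|p| + |s|) := by
      have : |p| - |s| ≤ |p| + |s| := by linarith [abs_nonneg s]
      nlinarith [abs_nonneg p, abs_nonneg s]
    linarith
  have h7 : X * η ≤ η * (|p| + |s|) := by
    have := abs_add_le p s
    nlinarith
  have h8 : -(|p * s| / 2) ≤ |p+s| * (|p| - |s|) + s * (p+s) := by
    rw [abs_mul]
    rcases abs_cases p with ⟨a,a'⟩|⟨a,a'⟩ <;> rcases abs_cases s with ⟨b,b'⟩|⟨b,b'⟩ <;>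
    rcases abs_cases (p+s) with ⟨c,c'⟩|⟨c,c'⟩ <;> rw [a,b,c] <;>
     nlinarith [sq_nonneg (p+s), sq_nonneg (p+1.4*s),sq_nonneg p, sq_nonneg s, mul_nonneg (abs_nonneg p) (abs_nonneg s)]
  nlinarith [mul_nonneg hη.le (add_nonneg (abs_nonneg p) (abs_nonneg s))]

theorem abs_div_sqrt_le (w η : ℝ) : |w / √(w^2+η^2)| ≤ 1 := by
  rw [abs_div, abs_of_nonneg (Real.sqrt_nonneg _)]
  exact div_le_one_of_le₀ (Real.abs_le_sqrt (by nlinarith)) (Real.sqrt_nonneg _)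

theorem abs_sqrt_sub_sqrt_le (p s η : ℝ) (hη : 0 < η) :
    |√(p^2+η^2) - √(s^2+η^2)| ≤ |p + s| := by
  have h1 : |p| ≤ √(p^2+η^2) := Real.abs_le_sqrt (by nlinarith)
  have h2 : |s| ≤ √(s^2+η^2) := Real.abs_le_sqrt (by nlinarith)
  have h3 : 0 < √(p^2+η^2) := by positivity
  have h4 : 0 < √(s^2+η^2) := by positivity
  have h5 : √(p^2+η^2)^2 = p^2+η^2 := Real.sq_sqrt (by positivity)
  have h6 : √(s^2+η^2)^2 = s^2+η^2 := Real.sq_sqrt (by positivity)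
  have h7 : |√(p^2+η^2) - √(s^2+η^2)| * (√(p^2+η^2) + √(s^2+η^2)) = |p+s| * |p-s| := by
    rw [← abs_of_pos (add_pos h3 h4), ← abs_mul, ← abs_mul]
    congr 1
    linear_combination h5 - h6
  have h8 : |p - s| ≤ √(p^2+η^2) + √(s^2+η^2) := (abs_sub _ _).trans (by linarith)
  have h9 : |p+s| * |p-s| ≤ |p+s| * (√(p^2+η^2) + √(s^2+η^2)) := by gcongr
  rw [← h7] at h9
  exact le_of_mul_le_mul_right h9 (by positivity)

theorem abs_deriv_sign_reg_mul_le (w η : ℝ) (hη : 0 < η) :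
    |η^2 / (w^2+η^2) / √(w^2+η^2)| * |w| ≤ 1 := by
  have h1 : η^2 / (w^2+η^2) ≤ 1 := div_le_one_of_le₀ (by nlinarith) (by positivity)
  have h := abs_div_sqrt_le w η
  rw [← abs_mul, div_mul_eq_mul_div, mul_div_assoc, abs_mul, abs_of_nonneg (a := η^2 / (w^2+η^2)) (by positivity)]
  exact mul_le_one₀ h1 (abs_nonneg _) h

/-- The weight whose derivative controls `|p s / m|` when `m' = p + s`. -/
theorem weight_deriv_lower_bound {m p s A B C ε η : ℝ} (hε : 0 < ε) (hη : 0 < η)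
    (hηε : η ≤ ε ^ 2) (hC : m * C = p * s) :
    |p * s| / (2 * √(m^2+ε^2)) - 6 * ε * (|p| + |s|) - 3 * (|A| + |B|) ≤
      ε^2 / (m^2+ε^2) / √(m^2+ε^2) * (p + s) *
          ((p+s) / √((p+s)^2+η^2) * (√(p^2+η^2) - √(s^2+η^2)) + s) +
        m / √(m^2+ε^2) *
          ((η^2 / ((p+s)^2+η^2) / √((p+s)^2+η^2) * B * (√(p^2+η^2) - √(s^2+η^2)) +
            (p+s) / √((p+s)^2+η^2) *
              (p / √(p^2+η^2) * (A + C) - s / √(s^2+η^2) * (B - A - C))) + (B - A - C)) := by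
  have hw := weight_aux p s η hη
  have hs := sign_aux p s η hη
  have hj := abs_sqrt_sub_sqrt_le p s η hη
  have hT' := abs_deriv_sign_reg_mul_le (p+s) η hη
  have hT := abs_div_sqrt_le (p+s) η
  have hP := abs_div_sqrt_le p η
  have hS := abs_div_sqrt_le s η
  have hM := abs_div_sqrt_le m ε
  have hθ1 : ε^2 / (m^2+ε^2) ≤ 1 := div_le_one_of_le₀ (by nlinarith) (by positivity)
  have hθ0 : 0 ≤ ε^2 / (m^2+ε^2) := by positivity
  have hR : 0 < √(m^2+ε^2) := by positivity
  have hRε : ε ≤ √(m^2+ε^2) := Real.le_sqrt_of_sq_le (by nlinarith)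
  set P := p / √(p^2+η^2)
  set S := s / √(s^2+η^2)
  set T := (p+s) / √((p+s)^2+η^2)
  set T' := η^2 / ((p+s)^2+η^2) / √((p+s)^2+η^2)
  set J := √(p^2+η^2) - √(s^2+η^2)
  set θ := ε^2 / (m^2+ε^2)
  set R := √(m^2+ε^2)
  have e : θ / R * (p + s) * (T * J + s) + m / R * ((T' * B * J + T * (P * (A + C) - S * (B - A - C))) + (B - A - C))
      = (θ * ((p + s) * (T * J + s)) + p * s * (T * (P + S) - 1)) / R
        + m / R * (T' * J * B + T * P * A - T * S * (B - A) + (B - A)) := by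
    rw [← hC]; field_simp; ring
  rw [e]
  have i1 : |T' * J * B + T * P * A - T * S * (B - A) + (B - A)| ≤ 3 * (|A| + |B|) := by
    have a1 : |T' * J * B| ≤ |B| := by
      rw [abs_mul, abs_mul]
      have : |T'| * |J| ≤ 1 := le_trans (by gcongr) hT'
      nlinarith [abs_nonneg B]
    have a2 : |T * P * A| ≤ |A| := by
      rw [abs_mul, abs_mul]
      have : |T| * |P| ≤ 1 := mul_le_one₀ hT (abs_nonneg _) hP
      nlinarith [abs_nonneg A]
    have a4 : |B - A| ≤ |B| + |A| := abs_sub _ _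
    have a3 : |T * S * (B - A)| ≤ |B| + |A| := by
      rw [abs_mul, abs_mul]
      have : |T| * |S| ≤ 1 := mul_le_one₀ hT (abs_nonneg _) hS
      nlinarith [abs_nonneg (B - A)]
    rw [abs_le] at *
    constructor <;> linarith [abs_nonneg A, abs_nonneg B]
  have i2 : -(3 * (|A| + |B|)) ≤ m / R * (T' * J * B + T * P * A - T * S * (B - A) + (B - A)) := by
    refine (abs_le.1 ?_).1
    rw [abs_mul]
    exact (mul_le_of_le_one_left (abs_nonneg _) hM).trans i1
  have hN : 0 ≤ |p * s| / 2 + η * (|p| + |s|) * 3 := by positivity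
  have i3 : |p * s| / 2 - 6 * η * (|p| + |s|) ≤
      θ * ((p + s) * (T * J + s)) + p * s * (T * (P + S) - 1) := by
    have : -(|p * s| / 2 + η * (|p| + |s|) * 3) ≤ θ * ((p + s) * (T * J + s)) := by
      have h1 := mul_le_mul_of_nonneg_left hw hθ0
      have h2 := mul_le_mul_of_nonneg_right hθ1 hN
      linarith
    linarith
  have i4 : |p * s| / (2 * R) - 6 * ε * (|p| + |s|) ≤
      (θ * ((p + s) * (T * J + s)) + p * s * (T * (P + S) - 1)) / R := by
    rw [le_div_iff₀ hR]
    refine le_trans ?_ i3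
    have : |p * s| / (2 * R) * R = |p * s| / 2 := by field_simp
    have h2 : η ≤ ε * R := hηε.trans (by rw [sq]; gcongr)
    have h3 : η * (|p| + |s|) ≤ ε * R * (|p| + |s|) := by gcongr
    linarith
  linarith

/-- A differentiable real function has zero derivative at almost every point of its zero set. -/
theorem ae_deriv_eq_zero_of_eq_zero {u u1 : ℝ → ℝ} (hu : ∀ z, HasDerivAt u (u1 z) z) :
    ∀ᵐ z, u z = 0 → u1 z = 0 := by
  have hc := countable_setOfPred_isolated_right_within (s := {z | u z = 0})
  filter_upwards [hc.ae_notMem volume] with z hz h0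
  by_contra h1
  refine hz ⟨h0, ?_⟩
  have h2 := (hu z).eventually_ne (c := 0) h1
  rw [nhdsWithin, ← Filter.empty_mem_iff_bot]
  have h3 : ∀ᶠ y in nhdsWithin z ({z | u z = 0} ∩ Set.Ioi z), u y ≠ 0 :=
    h2.filter_mono (nhdsWithin_mono z fun y hy => (ne_of_gt hy.2 : y ≠ z))
  have h4 : ∀ᶠ y in nhdsWithin z ({z | u z = 0} ∩ Set.Ioi z), u y = 0 :=
    eventually_nhdsWithin_of_forall fun y hy => hy.1
  have h5 : ∀ᶠ y in nhdsWithin z ({z | u z = 0} ∩ Set.Ioi z), False := by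
    filter_upwards [h3, h4] with y a b using a b
  exact h5

theorem abs_weight_le (m p s ε η : ℝ) (hη : 0 < η) :
    |m / √(m^2+ε^2) * ((p+s) / √((p+s)^2+η^2) * (√(p^2+η^2) - √(s^2+η^2)) + s)| ≤
      |p| + 2 * |s| := by
  have hM := abs_div_sqrt_le m ε
  have hT := abs_div_sqrt_le (p+s) η
  have hJ := abs_sqrt_sub_sqrt_le p s η hη
  rw [abs_mul]
  refine (mul_le_of_le_one_left (abs_nonneg _) hM).trans ((abs_add_le _ _).trans ?_)
  rw [abs_mul]
  have := mul_le_of_le_one_left (abs_nonneg (√(p^2+η^2) - √(s^2+η^2))) hT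
  linarith [abs_add_le p s]

theorem tendsto_abs_div_sqrt (m : ℝ) (hm : m ≠ 0) :
    Tendsto (fun ε : ℝ => |m| / √(m^2+ε^2)) (nhdsWithin 0 (Set.Ioi 0)) (nhds 1) := by
  have h : ContinuousAt (fun ε : ℝ => |m| / √(m^2+ε^2)) 0 := by
    apply ContinuousAt.div (by fun_prop) (by fun_prop)
    simp [Real.sqrt_sq_eq_abs, hm]
  have h2 := h.tendsto
  simp only [ne_eq, OfNat.ofNat_ne_zero, not_false_eq_true, zero_pow, add_zero,
    Real.sqrt_sq_eq_abs, div_self (abs_ne_zero.2 hm)] at h2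
  exact h2.mono_left nhdsWithin_le_nhds

/-- If `u'' v` and `(u v)''` are integrable near infinity and `u' v`, `u v'` tend to zero,
then `u' v'` is integrable near infinity. -/
theorem integrableOn_deriv_mul_deriv {u u1 u2 v v1 v2 : ℝ → ℝ} (x : ℝ)
    (hu : ∀ z, HasDerivAt u (u1 z) z) (hu1 : ∀ z, HasDerivAt u1 (u2 z) z)
    (hv : ∀ z, HasDerivAt v (v1 z) z) (hv1 : ∀ z, HasDerivAt v1 (v2 z) z)
    (hA : IntegrableOn (fun z => u2 z * v z) (Set.Ioi x))
    (hB : IntegrableOn (fun z => u2 z * v z + 2 * (u1 z * v1 z) + u z * v2 z) (Set.Ioi x))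
    (hp : Tendsto (fun z => u1 z * v z) atTop (nhds 0))
    (hs : Tendsto (fun z => u z * v1 z) atTop (nhds 0)) :
    IntegrableOn (fun z => u1 z * v1 z) (Set.Ioi x) := by
  have cu : Continuous u := continuous_iff_continuousAt.2 fun z => (hu z).continuousAt
  have cu1 : Continuous u1 := continuous_iff_continuousAt.2 fun z => (hu1 z).continuousAt
  have cv : Continuous v := continuous_iff_continuousAt.2 fun z => (hv z).continuousAt
  have cv1 : Continuous v1 := continuous_iff_continuousAt.2 fun z => (hv1 z).continuousAt
  set A := fun z => u2 z * v z with hAdef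
  set B := fun z => u2 z * v z + 2 * (u1 z * v1 z) + u z * v2 z with hBdef
  set p := fun z => u1 z * v z with hpdef
  set s := fun z => u z * v1 z with hsdef
  have cp : Continuous p := by fun_prop
  have cs : Continuous s := by fun_prop
  have hG : IntegrableOn (fun z => |A z| + |B z|) (Set.Ioi x) := hA.abs.add hB.abs
  set I := ∫ z in Set.Ioi x, (|A z| + |B z|) with hI
  have hm : ∀ z, HasDerivAt (fun z => u z * v z) (p z + s z) z := fun z => (hu z).mul (hv z)
  have hp' : ∀ z, HasDerivAt p (A z + u1 z * v1 z) z := fun z => (hu1 z).mul (hv z)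
  have hs' : ∀ z, HasDerivAt s (B z - A z - u1 z * v1 z) z := fun z =>
    ((hu z).mul (hv1 z)).congr_deriv (by simp only [hAdef, hBdef]; ring)
  have hw' : ∀ z, HasDerivAt (fun z => p z + s z) (B z) z := fun z =>
    ((hp' z).add (hs' z)).congr_deriv (by ring)
  have key : ∀ M, x ≤ M → |p M| ≤ 1 → |s M| ≤ 1 → ∀ ε, 0 < ε →
      ∫ z in x..M, |u1 z * v1 z| * (|u z * v z| / √((u z * v z)^2+ε^2)) ≤
        2 * (|p x| + 2 * |s x| + 3 + 3 * I + ε * ∫ z in x..M, 6 * (|p z| + |s z|)) := by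
    intro M hM hpM hsM ε hε
    have hη : 0 < ε ^ 2 := by positivity
    let Φ : ℝ → ℝ := fun z => (u z * v z) / √((u z * v z)^2+ε^2) *
      ((p z + s z) / √((p z + s z)^2+(ε^2)^2) * (√((p z)^2+(ε^2)^2) - √((s z)^2+(ε^2)^2)) + s z)
    have hΦ : ∀ z, HasDerivAt Φ _ z := fun z =>
      (hasDerivAt_sign_reg hε (hm z)).fun_mul (((hasDerivAt_sign_reg hη (hw' z)).fun_mul
        ((hasDerivAt_sqrt_reg hη (hp' z)).fun_sub (hasDerivAt_sqrt_reg hη (hs' z)))).fun_add (hs' z))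
    have cg : Continuous fun z => |u1 z * v1 z| * (|u z * v z| / √((u z * v z)^2+ε^2)) := by
      have : ∀ z, √((u z * v z)^2+ε^2) ≠ 0 := fun z => by positivity
      fun_prop (disch := assumption)
    have i1 : IntervalIntegrable
        (fun z => |u1 z * v1 z| * (|u z * v z| / √((u z * v z)^2+ε^2)) / 2) volume x M :=
      (cg.div_const 2).intervalIntegrable _ _
    have i2 : IntervalIntegrable (fun z => ε * (6 * (|p z| + |s z|))) volume x M :=
      Continuous.intervalIntegrable (by fun_prop) _ _
    have i3 : IntervalIntegrable (fun z => 3 * (|A z| + |B z|)) volume x M :=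
      ((intervalIntegrable_iff_integrableOn_Ioc_of_le hM).2
        (hG.mono_set Set.Ioc_subset_Ioi_self)).const_mul 3
    have h1 := intervalIntegral.integral_le_sub_of_hasDeriv_right_of_le hM
      (g := Φ) (fun z _ => (hΦ z).continuousAt.continuousWithinAt)
      (fun z _ => (hΦ z).hasDerivWithinAt)
      (φ := fun z => |u1 z * v1 z| * (|u z * v z| / √((u z * v z)^2+ε^2)) / 2
        - ε * (6 * (|p z| + |s z|)) - 3 * (|A z| + |B z|))
      ((intervalIntegrable_iff_integrableOn_Icc_of_le hM).1 ((i1.sub i2).sub i3))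
      (by
        intro z _
        have h := weight_deriv_lower_bound (m := u z * v z) (p := p z) (s := s z) (A := A z)
          (B := B z) (C := u1 z * v1 z) hε hη le_rfl (by simp only [hpdef, hsdef]; ring)
        have e : |p z * s z| = |u1 z * v1 z| * |u z * v z| := by
          rw [← abs_mul]; simp only [hpdef, hsdef]; congr 1; ring
        rw [e] at h
        refine le_trans (le_of_eq ?_) h
        rw [mul_div_assoc, mul_comm 2 (√_), ← div_div]
        ring)
    rw [intervalIntegral.integral_sub (i1.sub i2) i3, intervalIntegral.integral_sub i1 i2,
      intervalIntegral.integral_div] at h1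
    simp only [intervalIntegral.integral_const_mul] at h1 ⊢
    have h2 : ∫ z in x..M, (|A z| + |B z|) ≤ I := by
      rw [intervalIntegral.integral_of_le hM]
      exact setIntegral_mono_set hG (Eventually.of_forall fun z => by positivity)
        Set.Ioc_subset_Ioi_self.eventuallyLE
    have h3 := (abs_le.1 (abs_weight_le (u M * v M) (p M) (s M) ε _ hη)).2
    have h4 := (abs_le.1 (abs_weight_le (u x * v x) (p x) (s x) ε _ hη)).1
    change _ ≤ Φ M - Φ x at h1
    change Φ M ≤ _ at h3
    change _ ≤ Φ x at h4
    linarith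
  have key2 : ∀ M, x ≤ M → |p M| ≤ 1 → |s M| ≤ 1 →
      ∫ z in x..M, ‖u1 z * v1 z‖ ≤ 2 * (|p x| + 2 * |s x| + 3 + 3 * I) := by
    intro M hM hpM hsM
    have l1 : Tendsto (fun ε : ℝ =>
        ∫ z in x..M, |u1 z * v1 z| * (|u z * v z| / √((u z * v z)^2+ε^2)))
        (nhdsWithin 0 (Set.Ioi 0)) (nhds (∫ z in x..M, ‖u1 z * v1 z‖)) := by
      apply intervalIntegral.tendsto_integral_filter_of_dominated_convergence
        (fun z => |u1 z * v1 z|)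
      · filter_upwards [self_mem_nhdsWithin] with ε hε
        have : ∀ z, √((u z * v z)^2+ε^2) ≠ 0 := fun z => by
          have : 0 < ε := hε
          positivity
        apply Continuous.aestronglyMeasurable
        fun_prop (disch := assumption)
      · refine Eventually.of_forall fun ε => Eventually.of_forall fun z _ => ?_
        rw [Real.norm_eq_abs, abs_mul, abs_abs]
        apply mul_le_of_le_one_right (abs_nonneg _)
        rw [abs_div, abs_abs, ← abs_div]
        exact abs_div_sqrt_le _ _
      · exact Continuous.intervalIntegrable (by fun_prop) _ _
      · filter_upwards [ae_deriv_eq_zero_of_eq_zero hu, ae_deriv_eq_zero_of_eq_zero hv]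
          with z h1 h2 _
        rw [Real.norm_eq_abs]
        by_cases h : u z * v z = 0
        · have : u1 z * v1 z = 0 := by
            rcases mul_eq_zero.1 h with h | h
            · rw [h1 h, zero_mul]
            · rw [h2 h, mul_zero]
          simp [this]
        · simpa using (tendsto_abs_div_sqrt _ h).const_mul |u1 z * v1 z|
    have l2 : Tendsto (fun ε : ℝ =>
        2 * (|p x| + 2 * |s x| + 3 + 3 * I + ε * ∫ z in x..M, 6 * (|p z| + |s z|)))
        (nhdsWithin 0 (Set.Ioi 0)) (nhds (2 * (|p x| + 2 * |s x| + 3 + 3 * I))) := by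
      have : Continuous fun ε : ℝ =>
        2 * (|p x| + 2 * |s x| + 3 + 3 * I + ε * ∫ z in x..M, 6 * (|p z| + |s z|)) := by fun_prop
      have := (this.tendsto 0).mono_left (nhdsWithin_le_nhds (s := Set.Ioi 0))
      simpa using this
    exact le_of_tendsto_of_tendsto l1 l2 (by
      filter_upwards [self_mem_nhdsWithin] with ε hε using key M hM hpM hsM ε hε)
  refine integrableOn_Ioi_of_intervalIntegral_norm_bounded
    (2 * (|p x| + 2 * |s x| + 3 + 3 * I)) x (b := fun M : ℝ => M) (l := atTop)
    (fun M => (Continuous.integrableOn_Icc (by fun_prop)).mono_set Set.Ioc_subset_Icc_self)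
    tendsto_id ?_
  have ep : ∀ᶠ M in atTop, |p M| ≤ 1 := by
    have := hp.abs
    rw [abs_zero] at this
    exact this.eventually (eventually_le_nhds zero_lt_one)
  have es : ∀ᶠ M in atTop, |s M| ≤ 1 := by
    have := hs.abs
    rw [abs_zero] at this
    exact this.eventually (eventually_le_nhds zero_lt_one)
  filter_upwards [eventually_ge_atTop x, ep, es] with M h1 h2 h3 using key2 M h1 h2 h3

theorem hasDerivAt_intervalIntegral_param {g g' : ℝ → ℝ → ℝ}
    (hg : ∀ a z, HasDerivAt (fun a => g a z) (g' a z) a)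
    (cg : ∀ a, Continuous (g a)) (cg' : Continuous fun q : ℝ × ℝ => g' q.1 q.2) (b M a : ℝ) :
    HasDerivAt (fun a => ∫ z in b..M, g a z) (∫ z in b..M, g' a z) a := by
  have hK : IsCompact (Metric.closedBall a 1 ×ˢ Set.uIcc b M) :=
    (isCompact_closedBall a 1).prod isCompact_uIcc
  obtain ⟨c, hc⟩ := hK.exists_bound_of_continuousOn cg'.continuousOn
  refine (intervalIntegral.hasDerivAt_integral_of_dominated_loc_of_deriv_le
    (s := Metric.closedBall a 1) (bound := fun _ => c) (Metric.closedBall_mem_nhds a one_pos)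
    (Eventually.of_forall fun a => (cg a).aestronglyMeasurable)
    ((cg a).intervalIntegrable _ _) ?_ ?_ ?_ ?_).2
  · exact (cg'.comp (by fun_prop : Continuous fun z => (a, z))).aestronglyMeasurable
  · exact Eventually.of_forall fun z hz x hx => hc (x, z) ⟨hx, Set.uIoc_subset_uIcc hz⟩
  · exact intervalIntegrable_const
  · exact Eventually.of_forall fun z _ x _ => hg x z

theorem hasDerivAt_intervalIntegral_lower {g g' : ℝ → ℝ → ℝ}
    (hg : ∀ a z, HasDerivAt (fun a => g a z) (g' a z) a)
    (cg : Continuous fun q : ℝ × ℝ => g q.1 q.2)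
    (cg' : Continuous fun q : ℝ × ℝ => g' q.1 q.2) (M a : ℝ) :
    HasDerivAt (fun a => ∫ z in a..M, g a z) (-g a a + ∫ z in a..M, g' a z) a := by
  have cga : ∀ a, Continuous (g a) := fun a => cg.comp (by fun_prop : Continuous fun z => (a, z))
  have h1 := hasDerivAt_intervalIntegral_param hg cga cg' a M a
  have h2 : HasDerivAt (fun b => ∫ z in a..b, g b z) (g a a) a := by
    rw [hasDerivAt_iff_isLittleO, Asymptotics.isLittleO_iff]
    intro c hc
    obtain ⟨δ, hδ, hd⟩ := Metric.continuousAt_iff.1 (cg.continuousAt (x := (a, a))) c hc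
    filter_upwards [Metric.ball_mem_nhds a hδ] with b hb
    have e : (∫ z in a..b, g b z) - (∫ z in a..a, g a z) - (b - a) • g a a =
        ∫ z in a..b, (g b z - g a a) := by
      rw [intervalIntegral.integral_sub ((cga b).intervalIntegrable _ _)
        intervalIntegrable_const]
      simp
    rw [e]
    refine intervalIntegral.norm_integral_le_of_norm_le_const fun z hz => ?_
    have hb' : |b - a| < δ := hb
    have hz' : |z - a| ≤ |b - a| := by
      have := Set.uIoc_subset_uIcc hz
      exact Set.abs_sub_left_of_mem_uIcc this
    have : dist (b, z) (a, a) < δ := by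
      rw [Prod.dist_eq, max_lt_iff, Real.dist_eq, Real.dist_eq]
      exact ⟨hb', hz'.trans_lt hb'⟩
    exact (hd this).le
  have h3 : (fun a => ∫ z in a..M, g a z) = fun b => (∫ z in a..M, g b z) - ∫ z in a..b, g b z := by
    funext b
    rw [intervalIntegral.integral_interval_sub_left] <;> exact (cga b).intervalIntegrable _ _
  rw [h3]
  exact (h1.sub h2).congr_deriv (by ring)

theorem hasDerivAt_integral_Ioi_of_uniform {g g' : ℝ → ℝ → ℝ} {l β : ℝ → ℝ} (a : ℝ)
    (hl : Continuous l)
    (hfin : ∀ M b, l b < M → HasDerivAt (fun b => ∫ z in l b..M, g b z)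
      (β b + ∫ z in l b..M, g' b z) b)
    (hint : ∀ b, IntegrableOn (g b) (Set.Ioi (l b)))
    (hunif : TendstoUniformlyOn (fun (M : ℝ) b => ∫ z in Set.Ioc (l b) M, g' b z)
      (fun b => ∫ z in Set.Ioi (l b), g' b z) atTop (Metric.closedBall a 1)) :
    HasDerivAt (fun b => ∫ z in Set.Ioi (l b), g b z)
      (β a + ∫ z in Set.Ioi (l a), g' a z) a := by
  have hev : ∀ᶠ n : ℝ × ℝ in atTop ×ˢ nhds a, l n.2 < n.1 := by
    have h1 : ∀ᶠ M : ℝ in atTop, l a + 1 < M := eventually_gt_atTop _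
    have h2 : ∀ᶠ b in nhds a, l b < l a + 1 :=
      hl.continuousAt.eventually (gt_mem_nhds (lt_add_one _))
    filter_upwards [h1.prod_mk h2] with n hn using hn.2.trans hn.1
  refine hasDerivAt_of_tendstoUniformlyOnFilter (l := atTop)
    (f := fun (M : ℝ) b => ∫ z in l b..M, g b z) (f' := fun M b => β b + ∫ z in l b..M, g' b z)
    (g' := fun b => β b + ∫ z in Set.Ioi (l b), g' b z) ?_ ?_ ?_
  · have h1 : TendstoUniformlyOnFilter (fun (M : ℝ) b => β b + ∫ z in Set.Ioc (l b) M, g' b z)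
        (fun b => β b + ∫ z in Set.Ioi (l b), g' b z) atTop (nhds a) := by
      have h2 : TendstoUniformlyOn (fun (M : ℝ) b => β b + ∫ z in Set.Ioc (l b) M, g' b z)
          (fun b => β b + ∫ z in Set.Ioi (l b), g' b z) atTop (Metric.closedBall a 1) := by
        rw [Metric.tendstoUniformlyOn_iff] at hunif ⊢
        simpa only [dist_add_left] using hunif
      exact (tendstoUniformlyOn_iff_tendstoUniformlyOnFilter.1 h2).mono_right
        (le_principal_iff.2 (Metric.closedBall_mem_nhds a one_pos))
    refine h1.congr ?_
    filter_upwards [hev] with n hn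
    simp only [intervalIntegral.integral_of_le hn.le]
  · filter_upwards [hev] with n hn using hfin n.1 n.2 hn
  · exact Eventually.of_forall fun b => intervalIntegral_tendsto_integral_Ioi _ (hint b) tendsto_id

theorem hasDerivAt_integral_Ioi_param {g g' : ℝ → ℝ → ℝ} (x a : ℝ)
    (hg : ∀ a z, HasDerivAt (fun a => g a z) (g' a z) a)
    (cg : Continuous fun q : ℝ × ℝ => g q.1 q.2)
    (cg' : Continuous fun q : ℝ × ℝ => g' q.1 q.2)
    (hint : ∀ b, IntegrableOn (g b) (Set.Ioi x))
    (hunif : TendstoUniformlyOn (fun (M : ℝ) b => ∫ z in Set.Ioc x M, g' b z)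
      (fun b => ∫ z in Set.Ioi x, g' b z) atTop (Metric.closedBall a 1)) :
    HasDerivAt (fun b => ∫ z in Set.Ioi x, g b z) (∫ z in Set.Ioi x, g' a z) a := by
  have h := hasDerivAt_integral_Ioi_of_uniform (l := fun _ => x) (β := fun _ => 0) a
    continuous_const (fun M b _ => by
      rw [zero_add]
      exact hasDerivAt_intervalIntegral_param hg
        (fun a => cg.comp (by fun_prop : Continuous fun z => (a, z))) cg' x M b) hint hunif
  rwa [zero_add] at h

theorem hasDerivAt_integral_Ioi_lower {g g' : ℝ → ℝ → ℝ} (a : ℝ)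
    (hg : ∀ a z, HasDerivAt (fun a => g a z) (g' a z) a)
    (cg : Continuous fun q : ℝ × ℝ => g q.1 q.2)
    (cg' : Continuous fun q : ℝ × ℝ => g' q.1 q.2)
    (hint : ∀ b, IntegrableOn (g b) (Set.Ioi b))
    (hunif : TendstoUniformlyOn (fun (M : ℝ) b => ∫ z in Set.Ioc b M, g' b z)
      (fun b => ∫ z in Set.Ioi b, g' b z) atTop (Metric.closedBall a 1)) :
    HasDerivAt (fun b => ∫ z in Set.Ioi b, g b z) (-g a a + ∫ z in Set.Ioi a, g' a z) a :=
  hasDerivAt_integral_Ioi_of_uniform (l := fun b => b) (β := fun b => -g b b) a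
    continuous_id (fun M b _ => hasDerivAt_intervalIntegral_lower hg cg cg' M b) hint hunif
section PartialDerivatives

variable {G : ℝ → ℝ → ℝ → ℝ}

theorem hasDerivAt_fst_fderiv (h : ContDiff ℝ 1 (fun q : ℝ × ℝ × ℝ => G q.1 q.2.1 q.2.2)) (x y t : ℝ) :
    HasDerivAt (fun s => G s y t)
      (fderiv ℝ (fun q : ℝ × ℝ × ℝ => G q.1 q.2.1 q.2.2) (x, y, t) (1, 0, 0)) x :=
  ((h.differentiable one_ne_zero (x, y, t)).hasFDerivAt).comp_hasDerivAt x
    (f := fun s : ℝ => (s, y, t)) ((hasDerivAt_id x).prodMk (hasDerivAt_const x (y, t)))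

theorem hasDerivAt_snd_fderiv (h : ContDiff ℝ 1 (fun q : ℝ × ℝ × ℝ => G q.1 q.2.1 q.2.2)) (x y t : ℝ) :
    HasDerivAt (fun s => G x s t)
      (fderiv ℝ (fun q : ℝ × ℝ × ℝ => G q.1 q.2.1 q.2.2) (x, y, t) (0, 1, 0)) y :=
  ((h.differentiable one_ne_zero (x, y, t)).hasFDerivAt).comp_hasDerivAt y
    (f := fun s : ℝ => (x, s, t))
    ((hasDerivAt_const y x).prodMk ((hasDerivAt_id y).prodMk (hasDerivAt_const y t)))

theorem hasDerivAt_trd_fderiv (h : ContDiff ℝ 1 (fun q : ℝ × ℝ × ℝ => G q.1 q.2.1 q.2.2)) (x y t : ℝ) :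
    HasDerivAt (fun s => G x y s)
      (fderiv ℝ (fun q : ℝ × ℝ × ℝ => G q.1 q.2.1 q.2.2) (x, y, t) (0, 0, 1)) t :=
  ((h.differentiable one_ne_zero (x, y, t)).hasFDerivAt).comp_hasDerivAt t
    (f := fun s : ℝ => (x, y, s))
    ((hasDerivAt_const t x).prodMk ((hasDerivAt_const t y).prodMk (hasDerivAt_id t)))

theorem hasDerivAt_d1 (h : ContDiff ℝ 1 (fun q : ℝ × ℝ × ℝ => G q.1 q.2.1 q.2.2)) (x y t : ℝ) :
    HasDerivAt (fun s => G s y t) (d1₁₄ G x y t) x :=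
  (hasDerivAt_fst_fderiv h x y t).differentiableAt.hasDerivAt

theorem hasDerivAt_d2 (h : ContDiff ℝ 1 (fun q : ℝ × ℝ × ℝ => G q.1 q.2.1 q.2.2)) (x y t : ℝ) :
    HasDerivAt (fun s => G x s t) (d2₁₄ G x y t) y :=
  (hasDerivAt_snd_fderiv h x y t).differentiableAt.hasDerivAt

theorem hasDerivAt_d3 (h : ContDiff ℝ 1 (fun q : ℝ × ℝ × ℝ => G q.1 q.2.1 q.2.2)) (x y t : ℝ) :
    HasDerivAt (fun s => G x y s) (d3₁₄ G x y t) t :=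
  (hasDerivAt_trd_fderiv h x y t).differentiableAt.hasDerivAt

theorem hasDerivAt_diag (h : ContDiff ℝ 1 (fun q : ℝ × ℝ × ℝ => G q.1 q.2.1 q.2.2)) (x t : ℝ) :
    HasDerivAt (fun s => G s s t) (d1₁₄ G x x t + d2₁₄ G x x t) x := by
  have h1 : HasDerivAt (fun s => G s s t)
      (fderiv ℝ (fun q : ℝ × ℝ × ℝ => G q.1 q.2.1 q.2.2) (x, x, t) (1, 1, 0)) x :=
    ((h.differentiable one_ne_zero (x, x, t)).hasFDerivAt).comp_hasDerivAt x
      (f := fun s : ℝ => (s, s, t))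
      ((hasDerivAt_id x).prodMk ((hasDerivAt_id x).prodMk (hasDerivAt_const x t)))
  refine h1.congr_deriv ?_
  rw [(hasDerivAt_d1 h x x t).unique (hasDerivAt_fst_fderiv h x x t),
    (hasDerivAt_d2 h x x t).unique (hasDerivAt_snd_fderiv h x x t), ← map_add]
  simp

theorem fderiv_apply_contDiff {n : ℕ}
    (h : ContDiff ℝ (n + 1) (fun q : ℝ × ℝ × ℝ => G q.1 q.2.1 q.2.2)) (v : ℝ × ℝ × ℝ) :
    ContDiff ℝ n (fun q : ℝ × ℝ × ℝ =>
      fderiv ℝ (fun q : ℝ × ℝ × ℝ => G q.1 q.2.1 q.2.2) q v) :=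
  (h.fderiv_right le_rfl).clm_apply contDiff_const

theorem contDiff_d1 {n : ℕ}
    (h : ContDiff ℝ (n + 1) (fun q : ℝ × ℝ × ℝ => G q.1 q.2.1 q.2.2)) :
    ContDiff ℝ n (fun q : ℝ × ℝ × ℝ => d1₁₄ G q.1 q.2.1 q.2.2) := by
  rw [show (fun q : ℝ × ℝ × ℝ => d1₁₄ G q.1 q.2.1 q.2.2) = _ from
    funext fun q => (hasDerivAt_fst_fderiv (h.of_le (by simp)) q.1 q.2.1 q.2.2).deriv]
  exact fderiv_apply_contDiff h (1, 0, 0)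

theorem contDiff_d2 {n : ℕ}
    (h : ContDiff ℝ (n + 1) (fun q : ℝ × ℝ × ℝ => G q.1 q.2.1 q.2.2)) :
    ContDiff ℝ n (fun q : ℝ × ℝ × ℝ => d2₁₄ G q.1 q.2.1 q.2.2) := by
  rw [show (fun q : ℝ × ℝ × ℝ => d2₁₄ G q.1 q.2.1 q.2.2) = _ from
    funext fun q => (hasDerivAt_snd_fderiv (h.of_le (by simp)) q.1 q.2.1 q.2.2).deriv]
  exact fderiv_apply_contDiff h (0, 1, 0)

theorem contDiff_d3 {n : ℕ}
    (h : ContDiff ℝ (n + 1) (fun q : ℝ × ℝ × ℝ => G q.1 q.2.1 q.2.2)) :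
    ContDiff ℝ n (fun q : ℝ × ℝ × ℝ => d3₁₄ G q.1 q.2.1 q.2.2) := by
  rw [show (fun q : ℝ × ℝ × ℝ => d3₁₄ G q.1 q.2.1 q.2.2) = _ from
    funext fun q => (hasDerivAt_trd_fderiv (h.of_le (by simp)) q.1 q.2.1 q.2.2).deriv]
  exact fderiv_apply_contDiff h (0, 0, 1)

theorem d1_d2_comm (h : ContDiff ℝ 2 (fun q : ℝ × ℝ × ℝ => G q.1 q.2.1 q.2.2)) :
    d1₁₄ (d2₁₄ G) = d2₁₄ (d1₁₄ G) := by
  funext x y t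
  have h1 : ContDiff ℝ 1 (fun q : ℝ × ℝ × ℝ => G q.1 q.2.1 q.2.2) := h.of_le (by norm_num)
  have h2 : ContDiff ℝ ((1 : ℕ) + 1) (fun q : ℝ × ℝ × ℝ => G q.1 q.2.1 q.2.2) :=
    h.of_le (by norm_num)
  have hsymm : IsSymmSndFDerivAt ℝ (fun q : ℝ × ℝ × ℝ => G q.1 q.2.1 q.2.2) (x, y, t) :=
    h.contDiffAt.isSymmSndFDerivAt (by simp)
  have hd : DifferentiableAt ℝ (fderiv ℝ (fun q : ℝ × ℝ × ℝ => G q.1 q.2.1 q.2.2)) (x, y, t) :=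
    (h2.fderiv_right (m := (1 : ℕ)) le_rfl).differentiable (by simp) _
  have key : ∀ v w : ℝ × ℝ × ℝ, fderiv ℝ (fun q : ℝ × ℝ × ℝ =>
      fderiv ℝ (fun q : ℝ × ℝ × ℝ => G q.1 q.2.1 q.2.2) q v) (x, y, t) w =
      fderiv ℝ (fderiv ℝ (fun q : ℝ × ℝ × ℝ => G q.1 q.2.1 q.2.2)) (x, y, t) w v := by
    intro v w
    rw [fderiv_clm_apply hd (differentiableAt_const v)]
    simp
  have e1 : (fun q : ℝ × ℝ × ℝ => d1₁₄ G q.1 q.2.1 q.2.2) = fun q : ℝ × ℝ × ℝ =>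
      fderiv ℝ (fun q : ℝ × ℝ × ℝ => G q.1 q.2.1 q.2.2) q (1, 0, 0) :=
    funext fun q => (hasDerivAt_fst_fderiv h1 q.1 q.2.1 q.2.2).deriv
  have e2 : (fun q : ℝ × ℝ × ℝ => d2₁₄ G q.1 q.2.1 q.2.2) = fun q : ℝ × ℝ × ℝ =>
      fderiv ℝ (fun q : ℝ × ℝ × ℝ => G q.1 q.2.1 q.2.2) q (0, 1, 0) :=
    funext fun q => (hasDerivAt_snd_fderiv h1 q.1 q.2.1 q.2.2).deriv
  have c1 : ContDiff ℝ 1 (fun q : ℝ × ℝ × ℝ => d1₁₄ G q.1 q.2.1 q.2.2) := by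
    exact_mod_cast contDiff_d1 h2
  have c2 : ContDiff ℝ 1 (fun q : ℝ × ℝ × ℝ => d2₁₄ G q.1 q.2.1 q.2.2) := by
    exact_mod_cast contDiff_d2 h2
  calc d1₁₄ (d2₁₄ G) x y t = _ := (hasDerivAt_fst_fderiv c2 x y t).deriv
    _ = fderiv ℝ (fderiv ℝ (fun q : ℝ × ℝ × ℝ => G q.1 q.2.1 q.2.2)) (x, y, t)
        (1, 0, 0) (0, 1, 0) := by rw [e2, key]
    _ = fderiv ℝ (fderiv ℝ (fun q : ℝ × ℝ × ℝ => G q.1 q.2.1 q.2.2)) (x, y, t)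
        (0, 1, 0) (1, 0, 0) := hsymm _ _
    _ = d2₁₄ (d1₁₄ G) x y t := by
      rw [← key, ← e1]
      exact (hasDerivAt_snd_fderiv c1 x y t).deriv.symm

theorem contDiff_one_of_three (h : ContDiff ℝ 3 (fun q : ℝ × ℝ × ℝ => G q.1 q.2.1 q.2.2)) :
    ContDiff ℝ 1 (fun q : ℝ × ℝ × ℝ => G q.1 q.2.1 q.2.2) := h.of_le (by norm_num)

theorem contDiff_d1_two (h : ContDiff ℝ 3 (fun q : ℝ × ℝ × ℝ => G q.1 q.2.1 q.2.2)) :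
    ContDiff ℝ 2 (fun q : ℝ × ℝ × ℝ => d1₁₄ G q.1 q.2.1 q.2.2) := by
  exact_mod_cast contDiff_d1 (n := 2) (by exact_mod_cast h)

theorem contDiff_d2_two (h : ContDiff ℝ 3 (fun q : ℝ × ℝ × ℝ => G q.1 q.2.1 q.2.2)) :
    ContDiff ℝ 2 (fun q : ℝ × ℝ × ℝ => d2₁₄ G q.1 q.2.1 q.2.2) := by
  exact_mod_cast contDiff_d2 (n := 2) (by exact_mod_cast h)

theorem contDiff_d1_one (h : ContDiff ℝ 2 (fun q : ℝ × ℝ × ℝ => G q.1 q.2.1 q.2.2)) :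
    ContDiff ℝ 1 (fun q : ℝ × ℝ × ℝ => d1₁₄ G q.1 q.2.1 q.2.2) := by
  exact_mod_cast contDiff_d1 (n := 1) (by exact_mod_cast h)

theorem contDiff_d2_one (h : ContDiff ℝ 2 (fun q : ℝ × ℝ × ℝ => G q.1 q.2.1 q.2.2)) :
    ContDiff ℝ 1 (fun q : ℝ × ℝ × ℝ => d2₁₄ G q.1 q.2.1 q.2.2) := by
  exact_mod_cast contDiff_d2 (n := 1) (by exact_mod_cast h)

theorem continuous_d1 (h : ContDiff ℝ 1 (fun q : ℝ × ℝ × ℝ => G q.1 q.2.1 q.2.2)) :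
    Continuous (fun q : ℝ × ℝ × ℝ => d1₁₄ G q.1 q.2.1 q.2.2) :=
  (contDiff_d1 (n := 0) (by exact_mod_cast h)).continuous

theorem continuous_d2 (h : ContDiff ℝ 1 (fun q : ℝ × ℝ × ℝ => G q.1 q.2.1 q.2.2)) :
    Continuous (fun q : ℝ × ℝ × ℝ => d2₁₄ G q.1 q.2.1 q.2.2) :=
  (contDiff_d2 (n := 0) (by exact_mod_cast h)).continuous

theorem continuous_d3 (h : ContDiff ℝ 1 (fun q : ℝ × ℝ × ℝ => G q.1 q.2.1 q.2.2)) :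
    Continuous (fun q : ℝ × ℝ × ℝ => d3₁₄ G q.1 q.2.1 q.2.2) :=
  (contDiff_d3 (n := 0) (by exact_mod_cast h)).continuous

theorem Continuous.comp_curried₃ {X : Type*} [TopologicalSpace X]
    (h : Continuous (fun q : ℝ × ℝ × ℝ => G q.1 q.2.1 q.2.2)) {a b c : X → ℝ}
    (ha : Continuous a) (hb : Continuous b) (hc : Continuous c) :
    Continuous fun p => G (a p) (b p) (c p) :=
  h.comp (ha.prodMk (hb.prodMk hc))

theorem DXY_cube (h : ContDiff ℝ 3 (fun q : ℝ × ℝ × ℝ => G q.1 q.2.1 q.2.2)) (x y t : ℝ) :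
    DXY₁₄ (DXY₁₄ (DXY₁₄ G)) x y t =
      d1₁₄ (d1₁₄ (d1₁₄ G)) x y t + 3 * d2₁₄ (d1₁₄ (d1₁₄ G)) x y t
        + 3 * d1₁₄ (d2₁₄ (d2₁₄ G)) x y t + d2₁₄ (d2₁₄ (d2₁₄ G)) x y t := by
  have c1 := contDiff_d1_two h
  have c2 := contDiff_d2_two h
  have c11 := contDiff_d1_one c1
  have c12 := contDiff_d2_one c1
  have c22 := contDiff_d2_one c2
  have k12 : d1₁₄ (d2₁₄ G) = d2₁₄ (d1₁₄ G) := d1_d2_comm (h.of_le (by norm_num))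
  have e2 : DXY₁₄ (DXY₁₄ G) = fun x y t =>
      d1₁₄ (d1₁₄ G) x y t + 2 * d2₁₄ (d1₁₄ G) x y t + d2₁₄ (d2₁₄ G) x y t := by
    funext x y t
    have h1 : HasDerivAt (fun s => DXY₁₄ G s y t) _ x :=
      (hasDerivAt_d1 (c1.of_le (by norm_num)) x y t).add
        (hasDerivAt_d1 (c2.of_le (by norm_num)) x y t)
    have h2 : HasDerivAt (fun s => DXY₁₄ G x s t) _ y :=
      (hasDerivAt_d2 (c1.of_le (by norm_num)) x y t).add
        (hasDerivAt_d2 (c2.of_le (by norm_num)) x y t)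
    calc DXY₁₄ (DXY₁₄ G) x y t = _ := congrArg₂ (· + ·) h1.deriv h2.deriv
      _ = _ := by rw [k12]; ring
  rw [e2]
  have h1 := ((hasDerivAt_d1 c11 x y t).add ((hasDerivAt_d1 c12 x y t).const_mul 2)).add
    (hasDerivAt_d1 c22 x y t)
  have h2 := ((hasDerivAt_d2 c11 x y t).add ((hasDerivAt_d2 c12 x y t).const_mul 2)).add
    (hasDerivAt_d2 c22 x y t)
  refine (congrArg₂ (· + ·) h1.deriv h2.deriv).trans ?_
  have k112 : d1₁₄ (d2₁₄ (d1₁₄ G)) = d2₁₄ (d1₁₄ (d1₁₄ G)) := d1_d2_comm c1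
  have k122 : d2₁₄ (d2₁₄ (d1₁₄ G)) = d1₁₄ (d2₁₄ (d2₁₄ G)) := by
    rw [d1_d2_comm c2, k12]
  rw [k112, k122]
  ring

end PartialDerivatives
section ProductDerivatives

variable {A B : ℝ → ℝ → ℝ → ℝ}

theorem e1_mul : e1₁₄ (fun x y t z => A z y t * B x z t) =
    fun x y t z => A z y t * d1₁₄ B x z t := by
  funext x y t z
  exact deriv_const_mul_field (A z y t)

theorem e2_mul : e2₁₄ (fun x y t z => A z y t * B x z t) =
    fun x y t z => d2₁₄ A z y t * B x z t := by
  funext x y t z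
  exact deriv_mul_const_field (B x z t)

theorem e3_mul (hA : ContDiff ℝ 1 (fun q : ℝ × ℝ × ℝ => A q.1 q.2.1 q.2.2))
    (hB : ContDiff ℝ 1 (fun q : ℝ × ℝ × ℝ => B q.1 q.2.1 q.2.2)) :
    e3₁₄ (fun x y t z => A z y t * B x z t) =
    fun x y t z => d3₁₄ A z y t * B x z t + A z y t * d3₁₄ B x z t := by
  funext x y t z
  exact ((hasDerivAt_d3 hA z y t).mul (hasDerivAt_d3 hB x z t)).deriv

theorem e4_mul (hA : ContDiff ℝ 1 (fun q : ℝ × ℝ × ℝ => A q.1 q.2.1 q.2.2))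
    (hB : ContDiff ℝ 1 (fun q : ℝ × ℝ × ℝ => B q.1 q.2.1 q.2.2)) :
    e4₁₄ (fun x y t z => A z y t * B x z t) =
    fun x y t z => d1₁₄ A z y t * B x z t + A z y t * d2₁₄ B x z t := by
  funext x y t z
  exact ((hasDerivAt_d1 hA z y t).mul (hasDerivAt_d2 hB x z t)).deriv

theorem e1_e1_e4_mul (hA : ContDiff ℝ 1 (fun q : ℝ × ℝ × ℝ => A q.1 q.2.1 q.2.2))
    (hB : ContDiff ℝ 3 (fun q : ℝ × ℝ × ℝ => B q.1 q.2.1 q.2.2)) :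
    e1₁₄ (e1₁₄ (e4₁₄ (fun x y t z => A z y t * B x z t))) =
    fun x y t z => d1₁₄ A z y t * d1₁₄ (d1₁₄ B) x z t + A z y t * d2₁₄ (d1₁₄ (d1₁₄ B)) x z t := by
  have hB1 := contDiff_d1_two hB
  have hB2 := contDiff_d2_two hB
  have hB3 := contDiff_d1_one hB2
  have k : d1₁₄ (d1₁₄ (d2₁₄ B)) = d2₁₄ (d1₁₄ (d1₁₄ B)) := by
    rw [d1_d2_comm (hB.of_le (by norm_num)), d1_d2_comm hB1]
  rw [e4_mul hA (contDiff_one_of_three hB)]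
  have h1 : e1₁₄ (fun x y t z => d1₁₄ A z y t * B x z t + A z y t * d2₁₄ B x z t) =
      fun x y t z => d1₁₄ A z y t * d1₁₄ B x z t + A z y t * d1₁₄ (d2₁₄ B) x z t := by
    funext x y t z
    exact (((hasDerivAt_d1 (contDiff_one_of_three hB) x z t).const_mul _).add
      ((hasDerivAt_d1 (hB2.of_le (by norm_num)) x z t).const_mul _)).deriv
  rw [h1, ← k]
  funext x y t z
  exact (((hasDerivAt_d1 (hB1.of_le (by norm_num)) x z t).const_mul _).add
      ((hasDerivAt_d1 hB3 x z t).const_mul _)).deriv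

theorem e2_e2_e4_mul (hA : ContDiff ℝ 3 (fun q : ℝ × ℝ × ℝ => A q.1 q.2.1 q.2.2))
    (hB : ContDiff ℝ 1 (fun q : ℝ × ℝ × ℝ => B q.1 q.2.1 q.2.2)) :
    e2₁₄ (e2₁₄ (e4₁₄ (fun x y t z => A z y t * B x z t))) =
    fun x y t z => d1₁₄ (d2₁₄ (d2₁₄ A)) z y t * B x z t + d2₁₄ (d2₁₄ A) z y t * d2₁₄ B x z t := by
  have hA1 := contDiff_d1_two hA
  have hA2 := contDiff_d2_two hA
  have hA3 := contDiff_d2_one hA1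
  have k : d2₁₄ (d2₁₄ (d1₁₄ A)) = d1₁₄ (d2₁₄ (d2₁₄ A)) := by
    rw [d1_d2_comm hA2, d1_d2_comm (hA.of_le (by norm_num))]
  rw [e4_mul (contDiff_one_of_three hA) hB]
  have h1 : e2₁₄ (fun x y t z => d1₁₄ A z y t * B x z t + A z y t * d2₁₄ B x z t) =
      fun x y t z => d2₁₄ (d1₁₄ A) z y t * B x z t + d2₁₄ A z y t * d2₁₄ B x z t := by
    funext x y t z
    exact (((hasDerivAt_d2 (hA1.of_le (by norm_num)) z y t).mul_const _).add
      ((hasDerivAt_d2 (contDiff_one_of_three hA) z y t).mul_const _)).deriv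
  rw [h1, ← k]
  funext x y t z
  exact (((hasDerivAt_d2 hA3 z y t).mul_const _).add
      ((hasDerivAt_d2 (hA2.of_le (by norm_num)) z y t).mul_const _)).deriv

theorem e4_e4_mul (hA : ContDiff ℝ 3 (fun q : ℝ × ℝ × ℝ => A q.1 q.2.1 q.2.2))
    (hB : ContDiff ℝ 3 (fun q : ℝ × ℝ × ℝ => B q.1 q.2.1 q.2.2)) :
    e4₁₄ (e4₁₄ (fun x y t z => A z y t * B x z t)) =
    fun x y t z => d1₁₄ (d1₁₄ A) z y t * B x z t + 2 * (d1₁₄ A z y t * d2₁₄ B x z t)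
      + A z y t * d2₁₄ (d2₁₄ B) x z t := by
  rw [e4_mul (contDiff_one_of_three hA) (contDiff_one_of_three hB)]
  funext x y t z
  have a0 := hasDerivAt_d1 (contDiff_one_of_three hA) z y t
  have a1 := hasDerivAt_d1 ((contDiff_d1_two hA).of_le (by norm_num)) z y t
  have b0 := hasDerivAt_d2 (contDiff_one_of_three hB) x z t
  have b1 := hasDerivAt_d2 ((contDiff_d2_two hB).of_le (by norm_num)) x z t
  refine ((a1.mul b0).add (a0.mul b1)).deriv.trans ?_
  ring

theorem e4_e4_e4_mul (hA : ContDiff ℝ 3 (fun q : ℝ × ℝ × ℝ => A q.1 q.2.1 q.2.2))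
    (hB : ContDiff ℝ 3 (fun q : ℝ × ℝ × ℝ => B q.1 q.2.1 q.2.2)) :
    e4₁₄ (e4₁₄ (e4₁₄ (fun x y t z => A z y t * B x z t))) =
    fun x y t z => d1₁₄ (d1₁₄ (d1₁₄ A)) z y t * B x z t
      + 3 * (d1₁₄ (d1₁₄ A) z y t * d2₁₄ B x z t)
      + 3 * (d1₁₄ A z y t * d2₁₄ (d2₁₄ B) x z t)
      + A z y t * d2₁₄ (d2₁₄ (d2₁₄ B)) x z t := by
  rw [e4_e4_mul hA hB]
  funext x y t z
  have a0 := hasDerivAt_d1 (contDiff_one_of_three hA) z y t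
  have a1 := hasDerivAt_d1 ((contDiff_d1_two hA).of_le (by norm_num)) z y t
  have a2 := hasDerivAt_d1 (contDiff_d1_one (contDiff_d1_two hA)) z y t
  have b0 := hasDerivAt_d2 (contDiff_one_of_three hB) x z t
  have b1 := hasDerivAt_d2 ((contDiff_d2_two hB).of_le (by norm_num)) x z t
  have b2 := hasDerivAt_d2 (contDiff_d2_one (contDiff_d2_two hB)) x z t
  refine (((a2.mul b0).add ((a1.mul b1).const_mul 2)).add (a0.mul b2)).deriv.trans ?_
  ring

end ProductDerivatives

/-- A pair `(F, K)` where `F` solves the two linear equations and `K` solves the associated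
integral equation, together with the decay, convergence and uniqueness assumptions. -/
structure DressingPair (F K : ℝ → ℝ → ℝ → ℝ) : Prop where
  hF : ContDiff ℝ 3 (fun q : ℝ × ℝ × ℝ => F q.1 q.2.1 q.2.2)
  hK : ContDiff ℝ 3 (fun q : ℝ × ℝ × ℝ => K q.1 q.2.1 q.2.2)
  hwave : ∀ x y t : ℝ, d1₁₄ (d1₁₄ F) x y t = d2₁₄ (d2₁₄ F) x y t
  hlin : ∀ x y t : ℝ, d3₁₄ F x y t + DXY₁₄ (DXY₁₄ (DXY₁₄ F)) x y t = 0
  hinteq : ∀ x y t : ℝ, K x y t = F x y t + ∫ z in Set.Ioi x, F z y t * K x z t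
  hdecay : ∀ (x y t : ℝ) (k s n : ℕ), k + s + n ≤ 3 →
    Tendsto (fun z => (d1₁₄^[k] F) z y t * (d1₁₄^[s] (d2₁₄^[n] K)) x z t) atTop (nhds 0)
  hint : ∀ a b c d : ℕ, a + b + c + d ≤ 3 → ∀ x y t : ℝ,
    IntegrableOn
      (fun z => (e1₁₄^[a] (e2₁₄^[b] (e3₁₄^[c] (e4₁₄^[d]
        (fun x' y' t' z' => F z' y' t' * K x' z' t'))))) x y t z)
      (Set.Ioi x)
  hunif : ∀ a b c d : ℕ, a + b + c + d ≤ 3 → ∀ C : Set (ℝ × ℝ × ℝ), IsCompact C →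
    TendstoUniformlyOn
      (fun (M : ℝ) (q : ℝ × ℝ × ℝ) => ∫ z in Set.Ioc q.1 M,
        (e1₁₄^[a] (e2₁₄^[b] (e3₁₄^[c] (e4₁₄^[d]
          (fun x' y' t' z' => F z' y' t' * K x' z' t'))))) q.1 q.2.1 q.2.2 z)
      (fun q => ∫ z in Set.Ioi q.1,
        (e1₁₄^[a] (e2₁₄^[b] (e3₁₄^[c] (e4₁₄^[d]
          (fun x' y' t' z' => F z' y' t' * K x' z' t'))))) q.1 q.2.1 q.2.2 z)
      atTop C
  hinj : ∀ (x t : ℝ) (φ : ℝ → ℝ), Continuous φ →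
    (∀ y : ℝ, IntegrableOn (fun z => |F z y t * φ z|) (Set.Ioi x)) →
    (∀ y : ℝ, φ y = ∫ z in Set.Ioi x, F z y t * φ z) → ∀ y : ℝ, φ y = 0

namespace DressingPair

variable {F K : ℝ → ℝ → ℝ → ℝ}

theorem wave (h : DressingPair F K) : d2₁₄ (d2₁₄ F) = d1₁₄ (d1₁₄ F) := by
  funext x y t
  exact (h.hwave x y t).symm

theorem d3_F (h : DressingPair F K) (x y t : ℝ) :
    d3₁₄ F x y t = -4 * d1₁₄ (d1₁₄ (d1₁₄ F)) x y t - 4 * d2₁₄ (d1₁₄ (d1₁₄ F)) x y t := by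
  have h1 := h.hlin x y t
  rw [DXY_cube h.hF, h.wave] at h1
  linarith

theorem contDiff_K11 (h : DressingPair F K) :
    ContDiff ℝ 1 (fun q : ℝ × ℝ × ℝ => d1₁₄ (d1₁₄ K) q.1 q.2.1 q.2.2) :=
  contDiff_d1_one (contDiff_d1_two h.hK)

theorem contDiff_K22 (h : DressingPair F K) :
    ContDiff ℝ 1 (fun q : ℝ × ℝ × ℝ => d2₁₄ (d2₁₄ K) q.1 q.2.1 q.2.2) :=
  contDiff_d2_one (contDiff_d2_two h.hK)

theorem contDiff_F11 (h : DressingPair F K) :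
    ContDiff ℝ 1 (fun q : ℝ × ℝ × ℝ => d1₁₄ (d1₁₄ F) q.1 q.2.1 q.2.2) :=
  contDiff_d1_one (contDiff_d1_two h.hF)

theorem integrable_F_K (h : DressingPair F K) (x y t : ℝ) :
    IntegrableOn (fun z => F z y t * K x z t) (Set.Ioi x) :=
  h.hint 0 0 0 0 (by norm_num) x y t

theorem integrable_F_K1 (h : DressingPair F K) (x y t : ℝ) :
    IntegrableOn (fun z => F z y t * d1₁₄ K x z t) (Set.Ioi x) := by
  have h1 : IntegrableOn (fun z => e1₁₄ (fun x' y' t' z' => F z' y' t' * K x' z' t') x y t z)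
    (Set.Ioi x) := h.hint 1 0 0 0 (by norm_num) x y t
  rwa [e1_mul] at h1

theorem integrable_F_K11 (h : DressingPair F K) (x y t : ℝ) :
    IntegrableOn (fun z => F z y t * d1₁₄ (d1₁₄ K) x z t) (Set.Ioi x) := by
  have h1 : IntegrableOn (fun z => e1₁₄ (e1₁₄ (fun x' y' t' z' => F z' y' t' * K x' z' t')) x y t z)
    (Set.Ioi x) := h.hint 2 0 0 0 (by norm_num) x y t
  rwa [e1_mul, e1_mul] at h1

theorem integrable_F_K111 (h : DressingPair F K) (x y t : ℝ) :
    IntegrableOn (fun z => F z y t * d1₁₄ (d1₁₄ (d1₁₄ K)) x z t) (Set.Ioi x) := by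
  have h1 : IntegrableOn (fun z =>
      e1₁₄ (e1₁₄ (e1₁₄ (fun x' y' t' z' => F z' y' t' * K x' z' t'))) x y t z)
    (Set.Ioi x) := h.hint 3 0 0 0 (by norm_num) x y t
  rwa [e1_mul, e1_mul, e1_mul] at h1

theorem integrable_F2_K (h : DressingPair F K) (x y t : ℝ) :
    IntegrableOn (fun z => d2₁₄ F z y t * K x z t) (Set.Ioi x) := by
  have h1 : IntegrableOn (fun z => e2₁₄ (fun x' y' t' z' => F z' y' t' * K x' z' t') x y t z)
    (Set.Ioi x) := h.hint 0 1 0 0 (by norm_num) x y t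
  rwa [e2_mul] at h1

theorem integrable_F11_K (h : DressingPair F K) (x y t : ℝ) :
    IntegrableOn (fun z => d1₁₄ (d1₁₄ F) z y t * K x z t) (Set.Ioi x) := by
  have h1 : IntegrableOn (fun z => e2₁₄ (e2₁₄ (fun x' y' t' z' => F z' y' t' * K x' z' t')) x y t z)
    (Set.Ioi x) := h.hint 0 2 0 0 (by norm_num) x y t
  rwa [e2_mul, e2_mul, h.wave] at h1

theorem integrable_F112_K (h : DressingPair F K) (x y t : ℝ) :
    IntegrableOn (fun z => d2₁₄ (d1₁₄ (d1₁₄ F)) z y t * K x z t) (Set.Ioi x) := by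
  have h1 : IntegrableOn (fun z =>
      e2₁₄ (e2₁₄ (e2₁₄ (fun x' y' t' z' => F z' y' t' * K x' z' t'))) x y t z)
    (Set.Ioi x) := h.hint 0 3 0 0 (by norm_num) x y t
  rwa [e2_mul, e2_mul, e2_mul, h.wave] at h1

theorem integrable_dt (h : DressingPair F K) (x y t : ℝ) :
    IntegrableOn (fun z => d3₁₄ F z y t * K x z t + F z y t * d3₁₄ K x z t) (Set.Ioi x) := by
  have h1 : IntegrableOn (fun z => e3₁₄ (fun x' y' t' z' => F z' y' t' * K x' z' t') x y t z)
    (Set.Ioi x) := h.hint 0 0 1 0 (by norm_num) x y t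
  rwa [e3_mul (contDiff_one_of_three h.hF) (contDiff_one_of_three h.hK)] at h1

theorem integrable_dz (h : DressingPair F K) (x y t : ℝ) :
    IntegrableOn (fun z => d1₁₄ F z y t * K x z t + F z y t * d2₁₄ K x z t) (Set.Ioi x) := by
  have h1 : IntegrableOn (fun z => e4₁₄ (fun x' y' t' z' => F z' y' t' * K x' z' t') x y t z)
    (Set.Ioi x) := h.hint 0 0 0 1 (by norm_num) x y t
  rwa [e4_mul (contDiff_one_of_three h.hF) (contDiff_one_of_three h.hK)] at h1

theorem integrable_dzz (h : DressingPair F K) (x y t : ℝ) :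
    IntegrableOn (fun z => d1₁₄ (d1₁₄ F) z y t * K x z t + 2 * (d1₁₄ F z y t * d2₁₄ K x z t)
      + F z y t * d2₁₄ (d2₁₄ K) x z t) (Set.Ioi x) := by
  have h1 : IntegrableOn (fun z => e4₁₄ (e4₁₄ (fun x' y' t' z' => F z' y' t' * K x' z' t')) x y t z)
    (Set.Ioi x) := h.hint 0 0 0 2 (by norm_num) x y t
  rwa [e4_e4_mul h.hF h.hK] at h1

theorem integrable_dzzz (h : DressingPair F K) (x y t : ℝ) :
    IntegrableOn (fun z => d1₁₄ (d1₁₄ (d1₁₄ F)) z y t * K x z t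
      + 3 * (d1₁₄ (d1₁₄ F) z y t * d2₁₄ K x z t)
      + 3 * (d1₁₄ F z y t * d2₁₄ (d2₁₄ K) x z t)
      + F z y t * d2₁₄ (d2₁₄ (d2₁₄ K)) x z t) (Set.Ioi x) := by
  have h1 : IntegrableOn (fun z =>
      e4₁₄ (e4₁₄ (e4₁₄ (fun x' y' t' z' => F z' y' t' * K x' z' t'))) x y t z)
    (Set.Ioi x) := h.hint 0 0 0 3 (by norm_num) x y t
  rwa [e4_e4_e4_mul h.hF h.hK] at h1

theorem integrable_dxxz (h : DressingPair F K) (x y t : ℝ) :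
    IntegrableOn (fun z => d1₁₄ F z y t * d1₁₄ (d1₁₄ K) x z t
      + F z y t * d2₁₄ (d1₁₄ (d1₁₄ K)) x z t) (Set.Ioi x) := by
  have h1 : IntegrableOn (fun z =>
      e1₁₄ (e1₁₄ (e4₁₄ (fun x' y' t' z' => F z' y' t' * K x' z' t'))) x y t z)
    (Set.Ioi x) := h.hint 2 0 0 1 (by norm_num) x y t
  rwa [e1_e1_e4_mul (contDiff_one_of_three h.hF) h.hK] at h1

theorem integrable_dyyz (h : DressingPair F K) (x y t : ℝ) :
    IntegrableOn (fun z => d1₁₄ (d1₁₄ (d1₁₄ F)) z y t * K x z t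
      + d1₁₄ (d1₁₄ F) z y t * d2₁₄ K x z t) (Set.Ioi x) := by
  have h1 : IntegrableOn (fun z =>
      e2₁₄ (e2₁₄ (e4₁₄ (fun x' y' t' z' => F z' y' t' * K x' z' t'))) x y t z)
    (Set.Ioi x) := h.hint 0 2 0 1 (by norm_num) x y t
  rwa [e2_e2_e4_mul h.hF (contDiff_one_of_three h.hK), h.wave] at h1

theorem tendsto_F1_K (h : DressingPair F K) (x y t : ℝ) :
    Tendsto (fun z => d1₁₄ F z y t * K x z t) atTop (nhds 0) :=
  h.hdecay x y t 1 0 0 (by norm_num)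

theorem tendsto_F_K2 (h : DressingPair F K) (x y t : ℝ) :
    Tendsto (fun z => F z y t * d2₁₄ K x z t) atTop (nhds 0) :=
  h.hdecay x y t 0 0 1 (by norm_num)

theorem tendsto_F11_K (h : DressingPair F K) (x y t : ℝ) :
    Tendsto (fun z => d1₁₄ (d1₁₄ F) z y t * K x z t) atTop (nhds 0) :=
  h.hdecay x y t 2 0 0 (by norm_num)

theorem tendsto_F1_K2 (h : DressingPair F K) (x y t : ℝ) :
    Tendsto (fun z => d1₁₄ F z y t * d2₁₄ K x z t) atTop (nhds 0) :=
  h.hdecay x y t 1 0 1 (by norm_num)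

theorem tendsto_F_K22 (h : DressingPair F K) (x y t : ℝ) :
    Tendsto (fun z => F z y t * d2₁₄ (d2₁₄ K) x z t) atTop (nhds 0) :=
  h.hdecay x y t 0 0 2 (by norm_num)

theorem integrable_F1_K2 (h : DressingPair F K) (x y t : ℝ) :
    IntegrableOn (fun z => d1₁₄ F z y t * d2₁₄ K x z t) (Set.Ioi x) :=
  integrableOn_deriv_mul_deriv x
    (fun z => hasDerivAt_d1 (contDiff_one_of_three h.hF) z y t)
    (fun z => hasDerivAt_d1 ((contDiff_d1_two h.hF).of_le (by norm_num)) z y t)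
    (fun z => hasDerivAt_d2 (contDiff_one_of_three h.hK) x z t)
    (fun z => hasDerivAt_d2 ((contDiff_d2_two h.hK).of_le (by norm_num)) x z t)
    (h.integrable_F11_K x y t) (h.integrable_dzz x y t) (h.tendsto_F1_K x y t)
    (h.tendsto_F_K2 x y t)

theorem integrable_F_K22 (h : DressingPair F K) (x y t : ℝ) :
    IntegrableOn (fun z => F z y t * d2₁₄ (d2₁₄ K) x z t) (Set.Ioi x) := by
  have h1 := ((h.integrable_dzz x y t).sub (h.integrable_F11_K x y t)).sub
    ((h.integrable_F1_K2 x y t).const_mul 2)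
  refine h1.congr_fun (fun z _ => ?_) measurableSet_Ioi
  simp only [Pi.sub_apply]
  ring

/-- Differentiation with respect to the lower limit and the first argument of the kernel. -/
theorem hasDerivAt_integral_x (h : DressingPair F K) {B : ℝ → ℝ → ℝ → ℝ}
    (hB : ContDiff ℝ 1 (fun q : ℝ × ℝ × ℝ => B q.1 q.2.1 q.2.2))
    (hint : ∀ x y t : ℝ, IntegrableOn (fun z => F z y t * B x z t) (Set.Ioi x))
    (hunif : ∀ C : Set (ℝ × ℝ × ℝ), IsCompact C → TendstoUniformlyOn
      (fun (M : ℝ) (q : ℝ × ℝ × ℝ) =>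
        ∫ z in Set.Ioc q.1 M, F z q.2.1 q.2.2 * d1₁₄ B q.1 z q.2.2)
      (fun q => ∫ z in Set.Ioi q.1, F z q.2.1 q.2.2 * d1₁₄ B q.1 z q.2.2) atTop C)
    (x y t : ℝ) :
    HasDerivAt (fun b => ∫ z in Set.Ioi b, F z y t * B b z t)
      (-(F x y t * B x x t) + ∫ z in Set.Ioi x, F z y t * d1₁₄ B x z t) x := by
  have hC : IsCompact ((fun b : ℝ => (b, y, t)) '' Metric.closedBall x 1) :=
    (isCompact_closedBall x 1).image (by fun_prop)
  refine hasDerivAt_integral_Ioi_lower (g := fun b z => F z y t * B b z t)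
    (g' := fun b z => F z y t * d1₁₄ B b z t) x
    (fun b z => (hasDerivAt_d1 hB b z t).const_mul _)
    ((h.hF.continuous.comp_curried₃ continuous_snd continuous_const continuous_const).mul
      (hB.continuous.comp_curried₃ continuous_fst continuous_snd continuous_const))
    ((h.hF.continuous.comp_curried₃ continuous_snd continuous_const continuous_const).mul
      ((continuous_d1 hB).comp_curried₃ continuous_fst continuous_snd continuous_const))
    (fun b => hint b y t) ?_
  exact ((hunif _ hC).comp (fun b : ℝ => (b, y, t))).mono (Set.subset_preimage_image _ _)

/-- Differentiation with respect to the free argument of the kernel. -/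
theorem hasDerivAt_integral_y (h : DressingPair F K) {A : ℝ → ℝ → ℝ → ℝ}
    (hA : ContDiff ℝ 1 (fun q : ℝ × ℝ × ℝ => A q.1 q.2.1 q.2.2))
    (hint : ∀ x y t : ℝ, IntegrableOn (fun z => A z y t * K x z t) (Set.Ioi x))
    (hunif : ∀ C : Set (ℝ × ℝ × ℝ), IsCompact C → TendstoUniformlyOn
      (fun (M : ℝ) (q : ℝ × ℝ × ℝ) =>
        ∫ z in Set.Ioc q.1 M, d2₁₄ A z q.2.1 q.2.2 * K q.1 z q.2.2)
      (fun q => ∫ z in Set.Ioi q.1, d2₁₄ A z q.2.1 q.2.2 * K q.1 z q.2.2) atTop C)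
    (x y t : ℝ) :
    HasDerivAt (fun b => ∫ z in Set.Ioi x, A z b t * K x z t)
      (∫ z in Set.Ioi x, d2₁₄ A z y t * K x z t) y := by
  have hC : IsCompact ((fun b : ℝ => (x, b, t)) '' Metric.closedBall y 1) :=
    (isCompact_closedBall y 1).image (by fun_prop)
  refine hasDerivAt_integral_Ioi_param (g := fun b z => A z b t * K x z t)
    (g' := fun b z => d2₁₄ A z b t * K x z t) x y
    (fun b z => (hasDerivAt_d2 hA z b t).mul_const _)
    ((hA.continuous.comp_curried₃ continuous_snd continuous_fst continuous_const).mul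
      (h.hK.continuous.comp_curried₃ continuous_const continuous_snd continuous_const))
    (((continuous_d2 hA).comp_curried₃ continuous_snd continuous_fst continuous_const).mul
      (h.hK.continuous.comp_curried₃ continuous_const continuous_snd continuous_const))
    (fun b => hint x b t) ?_
  exact ((hunif _ hC).comp (fun b : ℝ => (x, b, t))).mono (Set.subset_preimage_image _ _)

theorem hasDerivAt_integral_t (h : DressingPair F K) (x y t : ℝ) :
    HasDerivAt (fun s => ∫ z in Set.Ioi x, F z y s * K x z s)
      (∫ z in Set.Ioi x, (d3₁₄ F z y t * K x z t + F z y t * d3₁₄ K x z t)) t := by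
  have hF1 := contDiff_one_of_three h.hF
  have hK1 := contDiff_one_of_three h.hK
  have hC : IsCompact ((fun b : ℝ => (x, y, b)) '' Metric.closedBall t 1) :=
    (isCompact_closedBall t 1).image (by fun_prop)
  have hunif : TendstoUniformlyOn
      (fun (M : ℝ) (q : ℝ × ℝ × ℝ) => ∫ z in Set.Ioc q.1 M,
        e3₁₄ (fun x' y' t' z' => F z' y' t' * K x' z' t') q.1 q.2.1 q.2.2 z)
      (fun q => ∫ z in Set.Ioi q.1,
        e3₁₄ (fun x' y' t' z' => F z' y' t' * K x' z' t') q.1 q.2.1 q.2.2 z) atTop _ :=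
    h.hunif 0 0 1 0 (by norm_num) _ hC
  rw [e3_mul hF1 hK1] at hunif
  refine hasDerivAt_integral_Ioi_param (g := fun b z => F z y b * K x z b)
    (g' := fun b z => d3₁₄ F z y b * K x z b + F z y b * d3₁₄ K x z b) x t
    (fun b z => (hasDerivAt_d3 hF1 z y b).mul (hasDerivAt_d3 hK1 x z b))
    ((h.hF.continuous.comp_curried₃ continuous_snd continuous_const continuous_fst).mul
      (h.hK.continuous.comp_curried₃ continuous_const continuous_snd continuous_fst))
    ((((continuous_d3 hF1).comp_curried₃ continuous_snd continuous_const continuous_fst).mul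
      (h.hK.continuous.comp_curried₃ continuous_const continuous_snd continuous_fst)).add
    ((h.hF.continuous.comp_curried₃ continuous_snd continuous_const continuous_fst).mul
      ((continuous_d3 hK1).comp_curried₃ continuous_const continuous_snd continuous_fst)))
    (fun b => h.integrable_F_K x y b) ?_
  exact (hunif.comp (fun b : ℝ => (x, y, b))).mono (Set.subset_preimage_image _ _)

theorem unif_dx (h : DressingPair F K) (C : Set (ℝ × ℝ × ℝ)) (hC : IsCompact C) :
    TendstoUniformlyOn
      (fun (M : ℝ) (q : ℝ × ℝ × ℝ) => ∫ z in Set.Ioc q.1 M, F z q.2.1 q.2.2 * d1₁₄ K q.1 z q.2.2)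
      (fun q => ∫ z in Set.Ioi q.1, F z q.2.1 q.2.2 * d1₁₄ K q.1 z q.2.2) atTop C := by
  have h1 : TendstoUniformlyOn
      (fun (M : ℝ) (q : ℝ × ℝ × ℝ) => ∫ z in Set.Ioc q.1 M,
        e1₁₄ (fun x' y' t' z' => F z' y' t' * K x' z' t') q.1 q.2.1 q.2.2 z)
      (fun q => ∫ z in Set.Ioi q.1,
        e1₁₄ (fun x' y' t' z' => F z' y' t' * K x' z' t') q.1 q.2.1 q.2.2 z) atTop C :=
    h.hunif 1 0 0 0 (by norm_num) C hC
  rwa [e1_mul] at h1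

theorem unif_dxx (h : DressingPair F K) (C : Set (ℝ × ℝ × ℝ)) (hC : IsCompact C) :
    TendstoUniformlyOn
      (fun (M : ℝ) (q : ℝ × ℝ × ℝ) =>
        ∫ z in Set.Ioc q.1 M, F z q.2.1 q.2.2 * d1₁₄ (d1₁₄ K) q.1 z q.2.2)
      (fun q => ∫ z in Set.Ioi q.1, F z q.2.1 q.2.2 * d1₁₄ (d1₁₄ K) q.1 z q.2.2) atTop C := by
  have h1 : TendstoUniformlyOn
      (fun (M : ℝ) (q : ℝ × ℝ × ℝ) => ∫ z in Set.Ioc q.1 M,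
        e1₁₄ (e1₁₄ (fun x' y' t' z' => F z' y' t' * K x' z' t')) q.1 q.2.1 q.2.2 z)
      (fun q => ∫ z in Set.Ioi q.1,
        e1₁₄ (e1₁₄ (fun x' y' t' z' => F z' y' t' * K x' z' t')) q.1 q.2.1 q.2.2 z) atTop C :=
    h.hunif 2 0 0 0 (by norm_num) C hC
  rwa [e1_mul, e1_mul] at h1

theorem unif_dxxx (h : DressingPair F K) (C : Set (ℝ × ℝ × ℝ)) (hC : IsCompact C) :
    TendstoUniformlyOn
      (fun (M : ℝ) (q : ℝ × ℝ × ℝ) =>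
        ∫ z in Set.Ioc q.1 M, F z q.2.1 q.2.2 * d1₁₄ (d1₁₄ (d1₁₄ K)) q.1 z q.2.2)
      (fun q => ∫ z in Set.Ioi q.1, F z q.2.1 q.2.2 * d1₁₄ (d1₁₄ (d1₁₄ K)) q.1 z q.2.2)
      atTop C := by
  have h1 : TendstoUniformlyOn
      (fun (M : ℝ) (q : ℝ × ℝ × ℝ) => ∫ z in Set.Ioc q.1 M,
        e1₁₄ (e1₁₄ (e1₁₄ (fun x' y' t' z' => F z' y' t' * K x' z' t'))) q.1 q.2.1 q.2.2 z)
      (fun q => ∫ z in Set.Ioi q.1,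
        e1₁₄ (e1₁₄ (e1₁₄ (fun x' y' t' z' => F z' y' t' * K x' z' t'))) q.1 q.2.1 q.2.2 z)
      atTop C :=
    h.hunif 3 0 0 0 (by norm_num) C hC
  rwa [e1_mul, e1_mul, e1_mul] at h1

theorem unif_dy (h : DressingPair F K) (C : Set (ℝ × ℝ × ℝ)) (hC : IsCompact C) :
    TendstoUniformlyOn
      (fun (M : ℝ) (q : ℝ × ℝ × ℝ) => ∫ z in Set.Ioc q.1 M, d2₁₄ F z q.2.1 q.2.2 * K q.1 z q.2.2)
      (fun q => ∫ z in Set.Ioi q.1, d2₁₄ F z q.2.1 q.2.2 * K q.1 z q.2.2) atTop C := by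
  have h1 : TendstoUniformlyOn
      (fun (M : ℝ) (q : ℝ × ℝ × ℝ) => ∫ z in Set.Ioc q.1 M,
        e2₁₄ (fun x' y' t' z' => F z' y' t' * K x' z' t') q.1 q.2.1 q.2.2 z)
      (fun q => ∫ z in Set.Ioi q.1,
        e2₁₄ (fun x' y' t' z' => F z' y' t' * K x' z' t') q.1 q.2.1 q.2.2 z) atTop C :=
    h.hunif 0 1 0 0 (by norm_num) C hC
  rwa [e2_mul] at h1

theorem unif_dyy (h : DressingPair F K) (C : Set (ℝ × ℝ × ℝ)) (hC : IsCompact C) :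
    TendstoUniformlyOn
      (fun (M : ℝ) (q : ℝ × ℝ × ℝ) =>
        ∫ z in Set.Ioc q.1 M, d2₁₄ (d2₁₄ F) z q.2.1 q.2.2 * K q.1 z q.2.2)
      (fun q => ∫ z in Set.Ioi q.1, d2₁₄ (d2₁₄ F) z q.2.1 q.2.2 * K q.1 z q.2.2) atTop C := by
  have h1 : TendstoUniformlyOn
      (fun (M : ℝ) (q : ℝ × ℝ × ℝ) => ∫ z in Set.Ioc q.1 M,
        e2₁₄ (e2₁₄ (fun x' y' t' z' => F z' y' t' * K x' z' t')) q.1 q.2.1 q.2.2 z)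
      (fun q => ∫ z in Set.Ioi q.1,
        e2₁₄ (e2₁₄ (fun x' y' t' z' => F z' y' t' * K x' z' t')) q.1 q.2.1 q.2.2 z) atTop C :=
    h.hunif 0 2 0 0 (by norm_num) C hC
  rwa [e2_mul, e2_mul] at h1

theorem unif_dyyy (h : DressingPair F K) (C : Set (ℝ × ℝ × ℝ)) (hC : IsCompact C) :
    TendstoUniformlyOn
      (fun (M : ℝ) (q : ℝ × ℝ × ℝ) =>
        ∫ z in Set.Ioc q.1 M, d2₁₄ (d1₁₄ (d1₁₄ F)) z q.2.1 q.2.2 * K q.1 z q.2.2)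
      (fun q => ∫ z in Set.Ioi q.1, d2₁₄ (d1₁₄ (d1₁₄ F)) z q.2.1 q.2.2 * K q.1 z q.2.2)
      atTop C := by
  have h1 : TendstoUniformlyOn
      (fun (M : ℝ) (q : ℝ × ℝ × ℝ) => ∫ z in Set.Ioc q.1 M,
        e2₁₄ (e2₁₄ (e2₁₄ (fun x' y' t' z' => F z' y' t' * K x' z' t'))) q.1 q.2.1 q.2.2 z)
      (fun q => ∫ z in Set.Ioi q.1,
        e2₁₄ (e2₁₄ (e2₁₄ (fun x' y' t' z' => F z' y' t' * K x' z' t'))) q.1 q.2.1 q.2.2 z)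
      atTop C :=
    h.hunif 0 3 0 0 (by norm_num) C hC
  rwa [e2_mul, e2_mul, e2_mul, h.wave] at h1

theorem K1_eq (h : DressingPair F K) (x y t : ℝ) :
    d1₁₄ K x y t = d1₁₄ F x y t - F x y t * K x x t +
      ∫ z in Set.Ioi x, F z y t * d1₁₄ K x z t := by
  have h1 := (hasDerivAt_d1 (contDiff_one_of_three h.hF) x y t).add
    (h.hasDerivAt_integral_x (contDiff_one_of_three h.hK) h.integrable_F_K h.unif_dx x y t)
  have h2 : (fun s => K s y t) = fun s => F s y t + ∫ z in Set.Ioi s, F z y t * K s z t :=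
    funext fun s => h.hinteq s y t
  have h3 := hasDerivAt_d1 (contDiff_one_of_three h.hK) x y t
  rw [h2] at h3
  rw [h3.unique h1]
  ring

theorem K11_eq (h : DressingPair F K) (x y t : ℝ) :
    d1₁₄ (d1₁₄ K) x y t = d1₁₄ (d1₁₄ F) x y t - d1₁₄ F x y t * K x x t
      - F x y t * (d1₁₄ K x x t + d2₁₄ K x x t) - F x y t * d1₁₄ K x x t +
      ∫ z in Set.Ioi x, F z y t * d1₁₄ (d1₁₄ K) x z t := by
  have hF := hasDerivAt_d1 (contDiff_one_of_three h.hF) x y t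
  have hK1 : ContDiff ℝ 1 (fun q : ℝ × ℝ × ℝ => d1₁₄ K q.1 q.2.1 q.2.2) :=
    (contDiff_d1_two h.hK).of_le (by norm_num)
  have h1 := ((hasDerivAt_d1 ((contDiff_d1_two h.hF).of_le (by norm_num)) x y t).sub
    (hF.mul (hasDerivAt_diag (contDiff_one_of_three h.hK) x t))).add
    (h.hasDerivAt_integral_x hK1 h.integrable_F_K1 h.unif_dxx x y t)
  have h2 : (fun s => d1₁₄ K s y t) = fun s => d1₁₄ F s y t - F s y t * K s s t +
      ∫ z in Set.Ioi s, F z y t * d1₁₄ K s z t := funext fun s => h.K1_eq s y t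
  have h3 := hasDerivAt_d1 hK1 x y t
  rw [h2] at h3
  rw [h3.unique h1]
  ring

/-- The second derivative of the diagonal function `x ↦ K x x t`. -/
theorem hasDerivAt_diag_deriv (h : DressingPair F K) (x t : ℝ) :
    HasDerivAt (fun s => d1₁₄ K s s t + d2₁₄ K s s t)
      (d1₁₄ (d1₁₄ K) x x t + 2 * d2₁₄ (d1₁₄ K) x x t + d2₁₄ (d2₁₄ K) x x t) x := by
  refine ((hasDerivAt_diag ((contDiff_d1_two h.hK).of_le (by norm_num)) x t).add
    (hasDerivAt_diag ((contDiff_d2_two h.hK).of_le (by norm_num)) x t)).congr_deriv ?_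
  rw [d1_d2_comm (h.hK.of_le (by norm_num))]
  ring

theorem K111_eq (h : DressingPair F K) (x y t : ℝ) :
    d1₁₄ (d1₁₄ (d1₁₄ K)) x y t = d1₁₄ (d1₁₄ (d1₁₄ F)) x y t - d1₁₄ (d1₁₄ F) x y t * K x x t
      - 2 * (d1₁₄ F x y t * (d1₁₄ K x x t + d2₁₄ K x x t))
      - F x y t * (d1₁₄ (d1₁₄ K) x x t + 2 * d2₁₄ (d1₁₄ K) x x t + d2₁₄ (d2₁₄ K) x x t)
      - d1₁₄ F x y t * d1₁₄ K x x t
      - F x y t * (d1₁₄ (d1₁₄ K) x x t + d2₁₄ (d1₁₄ K) x x t)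
      - F x y t * d1₁₄ (d1₁₄ K) x x t
      + ∫ z in Set.Ioi x, F z y t * d1₁₄ (d1₁₄ (d1₁₄ K)) x z t := by
  have hF := hasDerivAt_d1 (contDiff_one_of_three h.hF) x y t
  have hF1 := hasDerivAt_d1 ((contDiff_d1_two h.hF).of_le (by norm_num)) x y t
  have hF2 := hasDerivAt_d1 h.contDiff_F11 x y t
  have hK0 := hasDerivAt_diag (contDiff_one_of_three h.hK) x t
  have hK1 := hasDerivAt_diag ((contDiff_d1_two h.hK).of_le (by norm_num)) x t
  have h1 := (((hF2.sub (hF1.mul hK0)).sub (hF.mul (h.hasDerivAt_diag_deriv x t))).sub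
    (hF.mul hK1)).add
    (h.hasDerivAt_integral_x h.contDiff_K11 h.integrable_F_K11 h.unif_dxxx x y t)
  have h2 : (fun s => d1₁₄ (d1₁₄ K) s y t) = fun s => d1₁₄ (d1₁₄ F) s y t
      - d1₁₄ F s y t * K s s t - F s y t * (d1₁₄ K s s t + d2₁₄ K s s t)
      - F s y t * d1₁₄ K s s t + ∫ z in Set.Ioi s, F z y t * d1₁₄ (d1₁₄ K) s z t :=
    funext fun s => h.K11_eq s y t
  have h3 := hasDerivAt_d1 h.contDiff_K11 x y t
  rw [h2] at h3
  rw [h3.unique h1]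
  ring

theorem K2_eq (h : DressingPair F K) (x y t : ℝ) :
    d2₁₄ K x y t = d2₁₄ F x y t + ∫ z in Set.Ioi x, d2₁₄ F z y t * K x z t := by
  have h1 := (hasDerivAt_d2 (contDiff_one_of_three h.hF) x y t).add
    (h.hasDerivAt_integral_y (contDiff_one_of_three h.hF) h.integrable_F_K h.unif_dy x y t)
  have h2 : (fun s => K x s t) = fun s => F x s t + ∫ z in Set.Ioi x, F z s t * K x z t :=
    funext fun s => h.hinteq x s t
  have h3 := hasDerivAt_d2 (contDiff_one_of_three h.hK) x y t
  rw [h2] at h3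
  exact h3.unique h1

theorem K22_eq (h : DressingPair F K) (x y t : ℝ) :
    d2₁₄ (d2₁₄ K) x y t = d1₁₄ (d1₁₄ F) x y t +
      ∫ z in Set.Ioi x, d1₁₄ (d1₁₄ F) z y t * K x z t := by
  have hF2 : ContDiff ℝ 1 (fun q : ℝ × ℝ × ℝ => d2₁₄ F q.1 q.2.1 q.2.2) :=
    (contDiff_d2_two h.hF).of_le (by norm_num)
  have h1 := (hasDerivAt_d2 hF2 x y t).add
    (h.hasDerivAt_integral_y hF2 h.integrable_F2_K h.unif_dyy x y t)
  have h2 : (fun s => d2₁₄ K x s t) = fun s => d2₁₄ F x s t +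
      ∫ z in Set.Ioi x, d2₁₄ F z s t * K x z t := funext fun s => h.K2_eq x s t
  have h3 := hasDerivAt_d2 ((contDiff_d2_two h.hK).of_le (by norm_num)) x y t
  rw [h2] at h3
  rw [← h.wave]
  exact h3.unique h1

theorem K222_eq (h : DressingPair F K) (x y t : ℝ) :
    d2₁₄ (d2₁₄ (d2₁₄ K)) x y t = d2₁₄ (d1₁₄ (d1₁₄ F)) x y t +
      ∫ z in Set.Ioi x, d2₁₄ (d1₁₄ (d1₁₄ F)) z y t * K x z t := by
  have h1 := (hasDerivAt_d2 h.contDiff_F11 x y t).add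
    (h.hasDerivAt_integral_y h.contDiff_F11 h.integrable_F11_K h.unif_dyyy x y t)
  have h2 : (fun s => d2₁₄ (d2₁₄ K) x s t) = fun s => d1₁₄ (d1₁₄ F) x s t +
      ∫ z in Set.Ioi x, d1₁₄ (d1₁₄ F) z s t * K x z t := funext fun s => h.K22_eq x s t
  have h3 := hasDerivAt_d2 h.contDiff_K22 x y t
  rw [h2] at h3
  exact h3.unique h1

theorem K3_eq (h : DressingPair F K) (x y t : ℝ) :
    d3₁₄ K x y t = d3₁₄ F x y t +
      ∫ z in Set.Ioi x, (d3₁₄ F z y t * K x z t + F z y t * d3₁₄ K x z t) := by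
  have h1 := (hasDerivAt_d3 (contDiff_one_of_three h.hF) x y t).add
    (h.hasDerivAt_integral_t x y t)
  have h2 : (fun s => K x y s) = fun s => F x y s + ∫ z in Set.Ioi x, F z y s * K x z s :=
    funext fun s => h.hinteq x y s
  have h3 := hasDerivAt_d3 (contDiff_one_of_three h.hK) x y t
  rw [h2] at h3
  exact h3.unique h1

theorem integral_F11_K_sub_F_K22 (h : DressingPair F K) (x y t : ℝ) :
    (∫ z in Set.Ioi x, d1₁₄ (d1₁₄ F) z y t * K x z t) -
      (∫ z in Set.Ioi x, F z y t * d2₁₄ (d2₁₄ K) x z t) =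
      F x y t * d2₁₄ K x x t - d1₁₄ F x y t * K x x t := by
  rw [← integral_sub (h.integrable_F11_K x y t) (h.integrable_F_K22 x y t)]
  have hd : ∀ z ∈ Set.Ici x, HasDerivAt (fun z => d1₁₄ F z y t * K x z t - F z y t * d2₁₄ K x z t)
      (d1₁₄ (d1₁₄ F) z y t * K x z t - F z y t * d2₁₄ (d2₁₄ K) x z t) z := fun z _ => by
    have a0 := hasDerivAt_d1 (contDiff_one_of_three h.hF) z y t
    have a1 := hasDerivAt_d1 ((contDiff_d1_two h.hF).of_le (by norm_num)) z y t
    have b0 := hasDerivAt_d2 (contDiff_one_of_three h.hK) x z t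
    have b1 := hasDerivAt_d2 ((contDiff_d2_two h.hK).of_le (by norm_num)) x z t
    refine ((a1.mul b0).sub (a0.mul b1)).congr_deriv ?_
    ring
  rw [integral_Ioi_of_hasDerivAt_of_tendsto' hd
    ((h.integrable_F11_K x y t).sub (h.integrable_F_K22 x y t))
    ((h.tendsto_F1_K x y t).sub (h.tendsto_F_K2 x y t))]
  ring

/-- `K` solves the wave equation with the potential `-2 (d/dx) K(x,x,t)`. -/
theorem wave_K (h : DressingPair F K) (x y t : ℝ) :
    d2₁₄ (d2₁₄ K) x y t =
      d1₁₄ (d1₁₄ K) x y t + 2 * ((d1₁₄ K x x t + d2₁₄ K x x t) * K x y t) := by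
  set c := d1₁₄ K x x t + d2₁₄ K x x t with hc
  have hint : ∀ y, IntegrableOn (fun z => F z y t *
      (d1₁₄ (d1₁₄ K) x z t - d2₁₄ (d2₁₄ K) x z t + 2 * (c * K x z t))) (Set.Ioi x) ∧
      ∫ z in Set.Ioi x, F z y t *
        (d1₁₄ (d1₁₄ K) x z t - d2₁₄ (d2₁₄ K) x z t + 2 * (c * K x z t)) =
      (∫ z in Set.Ioi x, F z y t * d1₁₄ (d1₁₄ K) x z t) -
        (∫ z in Set.Ioi x, F z y t * d2₁₄ (d2₁₄ K) x z t) +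
        2 * c * ∫ z in Set.Ioi x, F z y t * K x z t := fun y => by
    have i1 := h.integrable_F_K11 x y t
    have i2 := h.integrable_F_K22 x y t
    have i3 := (h.integrable_F_K x y t).const_mul (2 * c)
    have e : (fun z => F z y t *
        (d1₁₄ (d1₁₄ K) x z t - d2₁₄ (d2₁₄ K) x z t + 2 * (c * K x z t))) = fun z =>
        F z y t * d1₁₄ (d1₁₄ K) x z t - F z y t * d2₁₄ (d2₁₄ K) x z t +
          2 * c * (F z y t * K x z t) := by
      funext z
      ring
    rw [e]
    refine ⟨(i1.sub i2).add i3, ?_⟩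
    exact (integral_add (i1.sub i2) i3).trans
      (congrArg₂ (· + ·) (integral_sub i1 i2) (integral_const_mul _ _))
  have key := h.hinj x t
    (fun y => d1₁₄ (d1₁₄ K) x y t - d2₁₄ (d2₁₄ K) x y t + 2 * (c * K x y t))
    (((h.contDiff_K11.continuous.comp_curried₃ continuous_const continuous_id continuous_const).sub
      (h.contDiff_K22.continuous.comp_curried₃ continuous_const continuous_id
        continuous_const)).add
      (((h.hK.continuous.comp_curried₃ continuous_const continuous_id continuous_const).const_mul
        c).const_mul 2))
    (fun y => (hint y).1.abs) (fun y => ?_) y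
  · linarith
  · rw [(hint y).2]
    linear_combination h.K11_eq x y t - h.K22_eq x y t + 2 * c * h.hinteq x y t -
      h.integral_F11_K_sub_F_K22 x y t

theorem K112_eq (h : DressingPair F K) (x y t : ℝ) :
    d2₁₄ (d1₁₄ (d1₁₄ K)) x y t =
      d2₁₄ (d2₁₄ (d2₁₄ K)) x y t - 2 * ((d1₁₄ K x x t + d2₁₄ K x x t) * d2₁₄ K x y t) := by
  have h1 := hasDerivAt_d2 h.contDiff_K22 x y t
  have h2 : (fun s => d2₁₄ (d2₁₄ K) x s t) = fun s =>
      d1₁₄ (d1₁₄ K) x s t + 2 * ((d1₁₄ K x x t + d2₁₄ K x x t) * K x s t) :=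
    funext fun s => h.wave_K x s t
  rw [h2] at h1
  have h3 := h1.unique ((hasDerivAt_d2 h.contDiff_K11 x y t).add
    (((hasDerivAt_d2 (contDiff_one_of_three h.hK) x y t).const_mul
      (d1₁₄ K x x t + d2₁₄ K x x t)).const_mul 2))
  linarith

theorem K122_eq (h : DressingPair F K) (x y t : ℝ) :
    d1₁₄ (d2₁₄ (d2₁₄ K)) x y t = d1₁₄ (d1₁₄ (d1₁₄ K)) x y t +
      2 * ((d1₁₄ (d1₁₄ K) x x t + 2 * d2₁₄ (d1₁₄ K) x x t + d2₁₄ (d2₁₄ K) x x t) * K x y t +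
        (d1₁₄ K x x t + d2₁₄ K x x t) * d1₁₄ K x y t) := by
  have h1 := hasDerivAt_d1 h.contDiff_K22 x y t
  have h2 : (fun s => d2₁₄ (d2₁₄ K) s y t) = fun s =>
      d1₁₄ (d1₁₄ K) s y t + 2 * ((d1₁₄ K s s t + d2₁₄ K s s t) * K s y t) :=
    funext fun s => h.wave_K s y t
  rw [h2] at h1
  exact h1.unique ((hasDerivAt_d1 h.contDiff_K11 x y t).add
    (((h.hasDerivAt_diag_deriv x t).mul
      (hasDerivAt_d1 (contDiff_one_of_three h.hK) x y t)).const_mul 2))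

theorem integrable_F111_K_add_F_K222 (h : DressingPair F K) (x y t : ℝ) :
    IntegrableOn (fun z => d1₁₄ (d1₁₄ (d1₁₄ F)) z y t * K x z t +
      F z y t * d2₁₄ (d2₁₄ (d2₁₄ K)) x z t) (Set.Ioi x) := by
  have hP := h.integrable_dyyz x y t
  have hQ := (h.integrable_dxxz x y t).add
    ((h.integrable_dz x y t).const_mul (2 * (d1₁₄ K x x t + d2₁₄ K x x t)))
  have hS := ((hP.add hQ).const_mul (3 / 2)).sub ((h.integrable_dzzz x y t).const_mul (1 / 2))
  refine IntegrableOn.congr_fun hS (fun z _ => ?_) measurableSet_Ioi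
  have e1 := h.wave_K x z t
  have e2 := h.K112_eq x z t
  simp only [Pi.sub_apply, Pi.add_apply]
  rw [e1, e2]
  ring

theorem integral_F111_K_add_F_K222 (h : DressingPair F K) (x y t : ℝ) :
    ∫ z in Set.Ioi x, (d1₁₄ (d1₁₄ (d1₁₄ F)) z y t * K x z t +
      F z y t * d2₁₄ (d2₁₄ (d2₁₄ K)) x z t) =
      -(d1₁₄ (d1₁₄ F) x y t * K x x t - d1₁₄ F x y t * d2₁₄ K x x t +
        F x y t * d2₁₄ (d2₁₄ K) x x t) := by
  have hd : ∀ z ∈ Set.Ici x, HasDerivAt (fun z => d1₁₄ (d1₁₄ F) z y t * K x z t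
        - d1₁₄ F z y t * d2₁₄ K x z t + F z y t * d2₁₄ (d2₁₄ K) x z t)
      (d1₁₄ (d1₁₄ (d1₁₄ F)) z y t * K x z t + F z y t * d2₁₄ (d2₁₄ (d2₁₄ K)) x z t) z :=
    fun z _ => by
      have a0 := hasDerivAt_d1 (contDiff_one_of_three h.hF) z y t
      have a1 := hasDerivAt_d1 ((contDiff_d1_two h.hF).of_le (by norm_num)) z y t
      have a2 := hasDerivAt_d1 h.contDiff_F11 z y t
      have b0 := hasDerivAt_d2 (contDiff_one_of_three h.hK) x z t
      have b1 := hasDerivAt_d2 ((contDiff_d2_two h.hK).of_le (by norm_num)) x z t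
      have b2 := hasDerivAt_d2 h.contDiff_K22 x z t
      refine (((a2.mul b0).sub (a1.mul b1)).add (a0.mul b2)).congr_deriv ?_
      ring
  rw [integral_Ioi_of_hasDerivAt_of_tendsto' hd (h.integrable_F111_K_add_F_K222 x y t)
    (((h.tendsto_F11_K x y t).sub (h.tendsto_F1_K2 x y t)).add (h.tendsto_F_K22 x y t))]
  ring

theorem integral_F_K3_add_K222 (h : DressingPair F K) (x y t : ℝ) :
    IntegrableOn (fun z => F z y t * (d3₁₄ K x z t + 4 * d2₁₄ (d2₁₄ (d2₁₄ K)) x z t))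
      (Set.Ioi x) ∧
    ∫ z in Set.Ioi x, F z y t * (d3₁₄ K x z t + 4 * d2₁₄ (d2₁₄ (d2₁₄ K)) x z t) =
      (∫ z in Set.Ioi x, (d3₁₄ F z y t * K x z t + F z y t * d3₁₄ K x z t)) +
      4 * (∫ z in Set.Ioi x, d2₁₄ (d1₁₄ (d1₁₄ F)) z y t * K x z t) +
      4 * ∫ z in Set.Ioi x, (d1₁₄ (d1₁₄ (d1₁₄ F)) z y t * K x z t +
        F z y t * d2₁₄ (d2₁₄ (d2₁₄ K)) x z t) := by
  have i1 := h.integrable_dt x y t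
  have i2 := (h.integrable_F112_K x y t).const_mul 4
  have i3 := (h.integrable_F111_K_add_F_K222 x y t).const_mul 4
  have e : (fun z => F z y t * (d3₁₄ K x z t + 4 * d2₁₄ (d2₁₄ (d2₁₄ K)) x z t)) = fun z =>
      (d3₁₄ F z y t * K x z t + F z y t * d3₁₄ K x z t) +
      4 * (d2₁₄ (d1₁₄ (d1₁₄ F)) z y t * K x z t) +
      4 * (d1₁₄ (d1₁₄ (d1₁₄ F)) z y t * K x z t +
        F z y t * d2₁₄ (d2₁₄ (d2₁₄ K)) x z t) := by
    funext z
    rw [h.d3_F]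
    ring
  rw [e]
  refine ⟨(i1.add i2).add i3, ?_⟩
  exact (integral_add (i1.add i2) i3).trans (congrArg₂ (· + ·)
    ((integral_add i1 i2).trans (congrArg _ (integral_const_mul _ _))) (integral_const_mul _ _))

theorem evolution_K (h : DressingPair F K) (x y t : ℝ) :
    d3₁₄ K x y t + 4 * d2₁₄ (d2₁₄ (d2₁₄ K)) x y t + 4 * d1₁₄ (d1₁₄ (d1₁₄ K)) x y t
      + 12 * (d1₁₄ K x x t + d2₁₄ K x x t) * d1₁₄ K x y t
      + 6 * (d1₁₄ (d1₁₄ K) x x t + 2 * d2₁₄ (d1₁₄ K) x x t + d2₁₄ (d2₁₄ K) x x t) * K x y t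
      = 0 := by
  set c := d1₁₄ K x x t + d2₁₄ K x x t with hc
  set c' := d1₁₄ (d1₁₄ K) x x t + 2 * d2₁₄ (d1₁₄ K) x x t + d2₁₄ (d2₁₄ K) x x t with hc'
  have hint : ∀ y, IntegrableOn (fun z => F z y t *
      (d3₁₄ K x z t + 4 * d2₁₄ (d2₁₄ (d2₁₄ K)) x z t + 4 * d1₁₄ (d1₁₄ (d1₁₄ K)) x z t
        + 12 * c * d1₁₄ K x z t + 6 * c' * K x z t)) (Set.Ioi x) ∧
      ∫ z in Set.Ioi x, F z y t *
      (d3₁₄ K x z t + 4 * d2₁₄ (d2₁₄ (d2₁₄ K)) x z t + 4 * d1₁₄ (d1₁₄ (d1₁₄ K)) x z t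
        + 12 * c * d1₁₄ K x z t + 6 * c' * K x z t) =
      (∫ z in Set.Ioi x, F z y t * (d3₁₄ K x z t + 4 * d2₁₄ (d2₁₄ (d2₁₄ K)) x z t)) +
        4 * (∫ z in Set.Ioi x, F z y t * d1₁₄ (d1₁₄ (d1₁₄ K)) x z t) +
        12 * c * (∫ z in Set.Ioi x, F z y t * d1₁₄ K x z t) +
        6 * c' * ∫ z in Set.Ioi x, F z y t * K x z t := fun y => by
    have i1 := (h.integral_F_K3_add_K222 x y t).1
    have i2 := (h.integrable_F_K111 x y t).const_mul 4
    have i3 := (h.integrable_F_K1 x y t).const_mul (12 * c)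
    have i4 := (h.integrable_F_K x y t).const_mul (6 * c')
    have e : (fun z => F z y t *
        (d3₁₄ K x z t + 4 * d2₁₄ (d2₁₄ (d2₁₄ K)) x z t + 4 * d1₁₄ (d1₁₄ (d1₁₄ K)) x z t
          + 12 * c * d1₁₄ K x z t + 6 * c' * K x z t)) = fun z =>
        F z y t * (d3₁₄ K x z t + 4 * d2₁₄ (d2₁₄ (d2₁₄ K)) x z t) +
          4 * (F z y t * d1₁₄ (d1₁₄ (d1₁₄ K)) x z t) +
          12 * c * (F z y t * d1₁₄ K x z t) + 6 * c' * (F z y t * K x z t) := by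
      funext z
      ring
    rw [e]
    refine ⟨((i1.add i2).add i3).add i4, ?_⟩
    exact (integral_add ((i1.add i2).add i3) i4).trans (congrArg₂ (· + ·)
      ((integral_add (i1.add i2) i3).trans (congrArg₂ (· + ·)
        ((integral_add i1 i2).trans (congrArg _ (integral_const_mul _ _)))
        (integral_const_mul _ _))) (integral_const_mul _ _))
  have slice : ∀ {G : ℝ → ℝ → ℝ → ℝ}, Continuous (fun q : ℝ × ℝ × ℝ => G q.1 q.2.1 q.2.2) →
      Continuous fun y => G x y t := fun hG =>
    hG.comp_curried₃ continuous_const continuous_id continuous_const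
  refine h.hinj x t
    (fun y => d3₁₄ K x y t + 4 * d2₁₄ (d2₁₄ (d2₁₄ K)) x y t + 4 * d1₁₄ (d1₁₄ (d1₁₄ K)) x y t
      + 12 * c * d1₁₄ K x y t + 6 * c' * K x y t)
    (((((slice (continuous_d3 (contDiff_one_of_three h.hK))).add
      ((slice (continuous_d2 h.contDiff_K22)).const_mul 4)).add
      ((slice (continuous_d1 h.contDiff_K11)).const_mul 4)).add
      ((slice (contDiff_d1_two h.hK).continuous).const_mul (12 * c))).add
      ((slice h.hK.continuous).const_mul (6 * c')))
    (fun y => (hint y).1.abs) (fun y => ?_) y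
  rw [(hint y).2, (h.integral_F_K3_add_K222 x y t).2, h.integral_F111_K_add_F_K222]
  have w := h.wave_K x x t
  rw [← hc] at w
  have e1 := h.K111_eq x y t
  rw [← hc, ← hc'] at e1
  have e2 := h.K1_eq x y t
  have e3 := h.hinteq x y t
  have e4 := h.d3_F x y t
  have e5 := h.K222_eq x y t
  have e6 := h.K3_eq x y t
  linear_combination e6 + 4 * e5 + 4 * e1 + 12 * c * e2 + 6 * c' * e3 + e4 +
    2 * F x y t * hc' + 6 * F x y t * w + 8 * (d1₁₄ F x y t + F x y t * K x x t) * hc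

end DressingPair
/-- Equation (23) of Example 8 (Theorem 8.1) in the real scalar case: a `C³` solution `K` of
`K(x,y,t) = F(x,y,t) + ∫ₓ^∞ F(z,y,t) K(x,z,t) dz`, where `F` solves the wave equation and the
third-order linear equation `F_t + (∂ₓ+∂ᵧ)³F = 0`, satisfies
`K_t + (∂ₓ+∂ᵧ)³K + 6 ((∂ₓ+∂ᵧ)K)·(d/dx)K(x,x,t) = 0`. -/
theorem stmt_14 (F K : ℝ → ℝ → ℝ → ℝ)
    (hF : ContDiff ℝ 3 (fun q : ℝ × ℝ × ℝ => F q.1 q.2.1 q.2.2))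
    (hK : ContDiff ℝ 3 (fun q : ℝ × ℝ × ℝ => K q.1 q.2.1 q.2.2))
    (hwave : ∀ x y t : ℝ, d1₁₄ (d1₁₄ F) x y t = d2₁₄ (d2₁₄ F) x y t)
    (hlin : ∀ x y t : ℝ, d3₁₄ F x y t + DXY₁₄ (DXY₁₄ (DXY₁₄ F)) x y t = 0)
    (hinteq : ∀ x y t : ℝ, K x y t = F x y t + ∫ z in Set.Ioi x, F z y t * K x z t)
    (hdecay : ∀ (x y t : ℝ) (k s n : ℕ), k + s + n ≤ 3 →
      Tendsto (fun z => (d1₁₄^[k] F) z y t * (d1₁₄^[s] (d2₁₄^[n] K)) x z t) atTop (nhds 0))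
    (hint : ∀ a b c d : ℕ, a + b + c + d ≤ 3 → ∀ x y t : ℝ,
      IntegrableOn
        (fun z => (e1₁₄^[a] (e2₁₄^[b] (e3₁₄^[c] (e4₁₄^[d]
          (fun x' y' t' z' => F z' y' t' * K x' z' t'))))) x y t z)
        (Set.Ioi x))
    (hunif : ∀ a b c d : ℕ, a + b + c + d ≤ 3 → ∀ C : Set (ℝ × ℝ × ℝ), IsCompact C →
      TendstoUniformlyOn
        (fun (M : ℝ) (q : ℝ × ℝ × ℝ) => ∫ z in Set.Ioc q.1 M,
          (e1₁₄^[a] (e2₁₄^[b] (e3₁₄^[c] (e4₁₄^[d]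
            (fun x' y' t' z' => F z' y' t' * K x' z' t'))))) q.1 q.2.1 q.2.2 z)
        (fun q => ∫ z in Set.Ioi q.1,
          (e1₁₄^[a] (e2₁₄^[b] (e3₁₄^[c] (e4₁₄^[d]
            (fun x' y' t' z' => F z' y' t' * K x' z' t'))))) q.1 q.2.1 q.2.2 z)
        atTop C)
    (hinj : ∀ (x t : ℝ) (φ : ℝ → ℝ), Continuous φ →
      (∀ y : ℝ, IntegrableOn (fun z => |F z y t * φ z|) (Set.Ioi x)) →
      (∀ y : ℝ, φ y = ∫ z in Set.Ioi x, F z y t * φ z) → ∀ y : ℝ, φ y = 0) :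
    ∀ x y t : ℝ,
      d3₁₄ K x y t + DXY₁₄ (DXY₁₄ (DXY₁₄ K)) x y t
        + 6 * DXY₁₄ K x y t * deriv (fun s => K s s t) x = 0 := by
  intro x y t
  have h : DressingPair F K := ⟨hF, hK, hwave, hlin, hinteq, hdecay, hint, hunif, hinj⟩
  rw [DXY_cube hK, (hasDerivAt_diag (contDiff_one_of_three hK) x t).deriv, DXY₁₄]
  linear_combination h.evolution_K x y t + 3 * h.K112_eq x y t + 3 * h.K122_eq x y t
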